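/- arXiv:2112.03366 — 3 statements merged into one kernel-verified Lean document; each statement's English description precedes it below -/
import Mathlib

section
/- Let n ≥ 7 and let G and H be simple graphs on n vertices that share n−1 cards. If the degree sequence of G has a hole, that is, if there exists an integer a with δ(G) < a < Δ(G) such that no vertex of G has degree a, then for every integer r ≥ 1 we have κ_r(G) = κ_r(H). -/
open SimpleGraph

/-- `kappa G r` is the number of `r`-cliques of the graph `G`. -/
noncomputable def kappa {V : Type*} (G : SimpleGraph V) (r : ℕ) : ℕ :=
  (G.cliqueSet r).ncard

/-- `degR G r v` is the number of `r`-cliques of `G` that contain the vertex `v`. -/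
noncomputable def degR {V : Type*} (G : SimpleGraph V) (r : ℕ) (v : V) : ℕ :=
  {s | s ∈ G.cliqueSet r ∧ v ∈ s}.ncard

/-- `deg G v` is the degree of the vertex `v` in `G`. -/
noncomputable def deg {V : Type*} (G : SimpleGraph V) (v : V) : ℕ :=
  (G.neighborSet v).ncard

/-- `gcard G v` is the card `G - v`: the induced subgraph of `G` on `V(G) \ {v}`. -/
def gcard {V : Type*} (G : SimpleGraph V) (v : V) : SimpleGraph {x : V // x ≠ v} :=
  G.induce {x : V | x ≠ v}

/-- The maximum degree `Δ(G)`. -/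
noncomputable def maxDeg {n : ℕ} (G : SimpleGraph (Fin n)) : ℕ :=
  Finset.univ.sup (fun v => deg G v)

/-- The minimum degree `δ(G)`. -/
noncomputable def minDeg {n : ℕ} (G : SimpleGraph (Fin n)) : ℕ :=
  sInf (Set.range (fun v => deg G v))

/-- `ℓ(G)`: the number of vertices of maximum degree. -/
noncomputable def numMaxDeg {n : ℕ} (G : SimpleGraph (Fin n)) : ℕ :=
  (Finset.univ.filter (fun v => deg G v = maxDeg G)).card

/-- `G` and `H` share `n-1` cards via the vertices `u`, `w` and the bijection `π`:
for every `v ≠ u`, the card `G - v` is isomorphic to the card `H - π(v)`. -/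
def ShareCardsVia {n : ℕ} (G H : SimpleGraph (Fin n)) (u w : Fin n)
    (π : {x : Fin n // x ≠ u} ≃ {y : Fin n // y ≠ w}) : Prop :=
  ∀ v : {x : Fin n // x ≠ u}, Nonempty (gcard G v.1 ≃g gcard H (π v).1)

/-- `G` and `H` share `n-1` cards. -/
def ShareCards {n : ℕ} (G H : SimpleGraph (Fin n)) : Prop :=
  ∃ (u w : Fin n) (π : {x : Fin n // x ≠ u} ≃ {y : Fin n // y ≠ w}),
    ShareCardsVia G H u w π

namespace CC

set_option linter.unusedSectionVars false

open scoped Classical in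
/-- degree -/
noncomputable def dg {V : Type*} [Fintype V] (G : SimpleGraph V) (x : V) : ℕ :=
  (Finset.univ.filter (fun y => G.Adj x y)).card

open scoped Classical in
/-- degree of `x` in the card `G - v` -/
noncomputable def dc {V : Type*} [Fintype V] (G : SimpleGraph V) (v x : V) : ℕ :=
  (Finset.univ.filter (fun y => y ≠ v ∧ G.Adj x y)).card

open scoped Classical in
/-- number of neighbours in `M` -/
noncomputable def mN {V : Type*} [Fintype V] (G : SimpleGraph V) (M : Finset V) (v : V) : ℕ :=
  (M.filter (fun y => G.Adj v y)).card

/-- normalised form of sharing a card -/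
def IsoAt {V : Type*} (G H : SimpleGraph V) (v : V) (σ : Equiv.Perm V) : Prop :=
  σ v = v ∧ ∀ x y, x ≠ v → y ≠ v → (G.Adj x y ↔ H.Adj (σ x) (σ y))

/-- normalised form of sharing all cards but one -/
def Sh {V : Type*} (G H : SimpleGraph V) (u : V) : Prop :=
  ∀ v, v ≠ u → ∃ σ : Equiv.Perm V, IsoAt G H v σ

section
open scoped Classical
variable {V : Type*} [Fintype V] {G H : SimpleGraph V} {u v : V} {σ : Equiv.Perm V}

lemma IsoAt.ne (h : IsoAt G H v σ) {x : V} : σ x ≠ v ↔ x ≠ v := by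
  have := h.1
  constructor
  · rintro h1 rfl; exact h1 this
  · intro h1 h2; exact h1 (σ.injective (h2.trans this.symm))

lemma IsoAt.symm (h : IsoAt G H v σ) : IsoAt H G v σ.symm := by
  refine ⟨?_, ?_⟩
  · rw [Equiv.symm_apply_eq]; exact h.1.symm
  · intro x y hx hy
    have := h.2 (σ.symm x) (σ.symm y) (by rw [← h.ne]; simpa) (by rw [← h.ne]; simpa)
    simpa using this.symm

lemma Sh.symm (h : Sh G H u) : Sh H G u := fun v hv =>
  let ⟨_, hs⟩ := h v hv; ⟨_, hs.symm⟩

lemma IsoAt.compl (h : IsoAt G H v σ) : IsoAt Gᶜ Hᶜ v σ := by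
  refine ⟨h.1, fun x y hx hy => ?_⟩
  simp [SimpleGraph.compl_adj, h.2 x y hx hy]

lemma Sh.compl (h : Sh G H u) : Sh Gᶜ Hᶜ u := fun v hv =>
  let ⟨_, hs⟩ := h v hv; ⟨_, hs.compl⟩

lemma dc_add (v x : V) : dc G v x + (if G.Adj x v then 1 else 0) = dg G x := by
  unfold dc dg
  split_ifs with h
  · have : (Finset.univ.filter (fun y => G.Adj x y)) =
      insert v (Finset.univ.filter (fun y => y ≠ v ∧ G.Adj x y)) := by
      ext y; simp; by_cases hy : y = v <;> simp [hy, h]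
    rw [this, Finset.card_insert_of_notMem (by simp)]
  · rw [add_zero]
    congr 1
    ext y; simp; rintro h1 rfl; exact h h1

lemma IsoAt.dc (h : IsoAt G H v σ) {x : V} (hx : x ≠ v) : dc G v x = dc H v (σ x) := by
  unfold CC.dc
  refine Finset.card_bij (fun y _ => σ y) ?_ (fun _ _ _ _ h => σ.injective h) ?_
  · intro y hy
    simp only [Finset.mem_filter, Finset.mem_univ, true_and] at hy ⊢
    exact ⟨h.ne.2 hy.1, (h.2 x y hx hy.1).1 hy.2⟩
  · intro y hy
    simp only [Finset.mem_filter, Finset.mem_univ, true_and] at hy ⊢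
    have h1 : σ.symm y ≠ v := by rw [← h.ne]; simpa using hy.1
    refine ⟨σ.symm y, ⟨h1, (h.2 x _ hx h1).2 (by simpa using hy.2)⟩, by simp⟩

lemma IsoAt.sum (h : IsoAt G H v σ) (M : Finset V) (hM : ∀ x, x ∈ M ↔ σ x ∈ M) (f : ℕ → ℤ) :
    ∑ x ∈ M.erase v, f (CC.dc G v x) = ∑ x ∈ M.erase v, f (CC.dc H v x) := by
  refine Finset.sum_equiv σ ?_ ?_
  · intro x; rw [Finset.mem_erase, Finset.mem_erase, h.ne, ← hM]
  · intro x hx; rw [h.dc (Finset.ne_of_mem_erase hx)]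

lemma sum_dc (M : Finset V) : ∑ x ∈ M.erase v, (dc G v x : ℤ) + mN G M v =
    ∑ x ∈ M.erase v, (dg G x : ℤ) := by
  have h1 : (mN G M v : ℤ) = ∑ x ∈ M.erase v, (if G.Adj x v then 1 else 0 : ℤ) := by
    unfold mN
    rw [Finset.sum_boole]
    congr 2
    ext y; simp only [Finset.mem_filter, Finset.mem_erase]
    constructor
    · rintro ⟨a, b⟩; exact ⟨⟨b.ne', a⟩, b.symm⟩
    · rintro ⟨a, b⟩; exact ⟨a.2, b.symm⟩
  rw [h1, ← Finset.sum_add_distrib]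
  refine Finset.sum_congr rfl fun x _ => ?_
  rw [← dc_add (G := G) v x]; push_cast; rfl

lemma mN_univ (v : V) : mN G Finset.univ v = dg G v := rfl

lemma dg_lt (x : V) : dg G x + 1 ≤ Fintype.card V := by
  have : Finset.univ.filter (fun y => G.Adj x y) ⊆ Finset.univ.erase x := by
    intro y hy; simp at hy ⊢; exact hy.ne'
  have h1 := Finset.card_le_card this
  rw [Finset.card_erase_of_mem (Finset.mem_univ _), Finset.card_univ] at h1
  have : 0 < Fintype.card V := Fintype.card_pos_iff.2 ⟨x⟩
  unfold dg; omega

lemma dg_compl (x : V) : dg Gᶜ x + dg G x + 1 = Fintype.card V := by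
  have h1 := Finset.card_filter_add_card_filter_not (s := Finset.univ.erase x) (fun y => G.Adj x y)
  rw [Finset.card_erase_of_mem (Finset.mem_univ _), Finset.card_univ] at h1
  have h2 : (Finset.univ.erase x).filter (fun y => G.Adj x y) =
    Finset.univ.filter (fun y => G.Adj x y) := by
    ext y; simp; intro h; exact h.ne'
  have h3 : (Finset.univ.erase x).filter (fun y => ¬ G.Adj x y) =
    Finset.univ.filter (fun y => Gᶜ.Adj x y) := by
    ext y; simp [SimpleGraph.compl_adj]; intro h; exact ne_comm
  rw [h2, h3] at h1
  have h4 : dg Gᶜ x = (Finset.univ.filter (fun y => Gᶜ.Adj x y)).card := by unfold dg; congr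
  rw [h4]
  have : 0 < Fintype.card V := Fintype.card_pos_iff.2 ⟨x⟩
  simp only [dg]; omega

lemma Sh.eps (h : Sh G H u) (hn : 7 ≤ Fintype.card V) :
    ∃ e : ℤ, (e = 0 ∨ e = 1 ∨ e = -1) ∧ (dg H u : ℤ) - dg G u = (Fintype.card V - 3) * e ∧
      ∀ v, v ≠ u → (dg G v : ℤ) = dg H v + e := by
  have key : ∀ v, v ≠ u → ∑ x, (dg G x : ℤ) - 2 * dg G v = ∑ x, (dg H x : ℤ) - 2 * dg H v := by
    intro v hv
    obtain ⟨σ, hs⟩ := h v hv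
    have h1 := hs.sum Finset.univ (by simp) (fun k => (k : ℤ))
    have h2 := sum_dc (G := G) (v := v) Finset.univ
    have h3 := sum_dc (G := H) (v := v) Finset.univ
    have h4 := Finset.sum_erase_add Finset.univ (fun x => (dg G x : ℤ)) (Finset.mem_univ v)
    have h5 := Finset.sum_erase_add Finset.univ (fun x => (dg H x : ℤ)) (Finset.mem_univ v)
    rw [mN_univ] at h2 h3
    linarith
  have hsum : ∑ v ∈ Finset.univ.erase u, (∑ x, (dg G x : ℤ) - 2 * dg G v) =
      ∑ v ∈ Finset.univ.erase u, (∑ x, (dg H x : ℤ) - 2 * dg H v) :=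
    Finset.sum_congr rfl fun v hv => key v (Finset.ne_of_mem_erase hv)
  rw [Finset.sum_sub_distrib, Finset.sum_sub_distrib, ← Finset.mul_sum, ← Finset.mul_sum] at hsum
  have h4 := Finset.sum_erase_add Finset.univ (fun x => (dg G x : ℤ)) (Finset.mem_univ u)
  have h5 := Finset.sum_erase_add Finset.univ (fun x => (dg H x : ℤ)) (Finset.mem_univ u)
  simp only [Finset.sum_const, Finset.card_erase_of_mem (Finset.mem_univ _), Finset.card_univ,
    nsmul_eq_mul] at hsum
  rw [Nat.cast_sub (by omega)] at hsum
  obtain ⟨v, hv⟩ : ∃ v, v ≠ u := by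
    have : 1 < Fintype.card V := by omega
    have := Fintype.one_lt_card_iff_nontrivial.1 this
    exact exists_ne u
  have hk := key v hv
  have hgu := dg_lt (G := G) u
  have hhu := dg_lt (G := H) u
  set n := Fintype.card V
  set DG := ∑ x, (dg G x : ℤ)
  set DH := ∑ x, (dg H x : ℤ)
  set e : ℤ := dg G v - dg H v with he
  have hD : DG - DH = 2 * e := by omega
  have hm : (dg H u : ℤ) - dg G u = (n - 3) * e := by
    push_cast at hsum
    have : ((n : ℤ) - 3) * (DG - DH) = 2 * ((dg H u : ℤ) - dg G u) := by linear_combination hsum - 2 * h5 + 2 * h4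
    rw [hD] at this
    linarith
  refine ⟨e, ?_, hm, ?_⟩
  · have h7 : (7 : ℤ) ≤ n := by exact_mod_cast hn
    have hlt : e < 2 := by
      by_contra hc
      have : 2 * ((n : ℤ) - 3) ≤ (n - 3) * e := by nlinarith
      omega
    have hgt : -2 < e := by
      by_contra hc
      have : (n - 3) * e ≤ -2 * ((n : ℤ) - 3) := by nlinarith
      omega
    omega
  · intro x hx
    have := key x hx
    omega

end
end CC

namespace CC
section
open scoped Classical
variable {V : Type*} [Fintype V] {G H : SimpleGraph V} {u v : V} {σ : Equiv.Perm V}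

/-- vertices other than `u` of degree `k` -/
noncomputable def cA (G : SimpleGraph V) (u : V) (k : ℕ) : ℕ :=
  (Finset.univ.filter (fun x => x ≠ u ∧ dg G x = k)).card

/-- neighbours of `u` of degree `k` -/
noncomputable def cP (G : SimpleGraph V) (u : V) (k : ℕ) : ℕ :=
  (Finset.univ.filter (fun x => (x ≠ u ∧ dg G x = k) ∧ G.Adj x u)).card

lemma ind_dc (v x : V) (k : ℕ) : (if dc G v x = k then 1 else 0 : ℤ) =
    (if dg G x = k then 1 else 0) * (1 - if G.Adj x v then 1 else 0) +
    (if dg G x = k + 1 then 1 else 0) * (if G.Adj x v then 1 else 0) := by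
  have := dc_add (G := G) v x
  by_cases h : G.Adj x v <;> simp only [h, if_true, if_false] at this ⊢ <;> split_ifs <;> omega

lemma T_inner (x : V) (k : ℕ) :
    ∑ v ∈ (Finset.univ.erase u).erase x, (if dc G v x = k then 1 else 0 : ℤ) =
    (if dg G x = k then 1 else 0) * ((((Finset.univ.erase u).erase x).card : ℤ)
      - (k - if G.Adj x u then 1 else 0)) +
    (if dg G x = k + 1 then 1 else 0) * ((k + 1) - if G.Adj x u then 1 else 0) := by
  have h1 : ∑ v ∈ (Finset.univ.erase u).erase x, (if G.Adj x v then 1 else 0 : ℤ) =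
      (dg G x : ℤ) - if G.Adj x u then 1 else 0 := by
    rw [← dc_add (G := G) u x]
    unfold dc
    rw [Finset.sum_boole]
    push_cast
    rw [add_sub_cancel_right]
    congr 2
    ext y
    simp only [Finset.mem_filter, Finset.mem_erase, Finset.mem_univ, and_true, true_and]
    constructor
    · rintro ⟨a, b⟩; exact ⟨a.2, b⟩
    · rintro ⟨a, b⟩; exact ⟨⟨b.ne', a⟩, b⟩
  rw [Finset.sum_congr rfl fun v _ => ind_dc v x k, Finset.sum_add_distrib, ← Finset.mul_sum,
    ← Finset.mul_sum, Finset.sum_sub_distrib, h1]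
  simp only [Finset.sum_const, nsmul_eq_mul, mul_one]
  by_cases h : dg G x = k
  · simp [h]
  · by_cases h' : dg G x = k + 1
    · simp [h']
    · simp [h, h']

lemma T_eq (hn : 7 ≤ Fintype.card V) (k : ℕ) :
    ∑ v ∈ Finset.univ.erase u, ∑ x ∈ Finset.univ.erase v, (if dc G v x = k then 1 else 0 : ℤ) =
    (if dg G u = k then 1 else 0) * ((Fintype.card V : ℤ) - 1 - k) +
    (if dg G u = k + 1 then 1 else 0) * (k + 1) +
    ((Fintype.card V : ℤ) - 2 - k) * cA G u k + cP G u k + (k + 1) * cA G u (k + 1)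
      - cP G u (k + 1) := by
  have hswap : ∑ v ∈ Finset.univ.erase u, ∑ x ∈ Finset.univ.erase v,
      (if dc G v x = k then 1 else 0 : ℤ) =
      ∑ x, ∑ v ∈ (Finset.univ.erase u).erase x, (if dc G v x = k then 1 else 0 : ℤ) := by
    refine Finset.sum_comm' ?_
    intro x y; simp; tauto
  rw [hswap, ← Finset.sum_erase_add _ _ (Finset.mem_univ u), T_inner]
  have hA : ∀ k, (cA G u k : ℤ) = ∑ x ∈ Finset.univ.erase u, (if dg G x = k then 1 else 0 : ℤ) := by
    intro k
    unfold cA; rw [Finset.sum_boole]; congr 2; ext y; simp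
  have hP : ∀ k, (cP G u k : ℤ) = ∑ x ∈ Finset.univ.erase u,
      (if dg G x = k then 1 else 0 : ℤ) * (if G.Adj x u then 1 else 0) := by
    intro k
    unfold cP
    simp only [← ite_and, mul_ite, mul_one, mul_zero]
    rw [Finset.sum_boole]; congr 2; ext y; simp; tauto
  have hrest : ∑ x ∈ Finset.univ.erase u, ∑ v ∈ (Finset.univ.erase u).erase x,
      (if dc G v x = k then 1 else 0 : ℤ) =
    ((Fintype.card V : ℤ) - 2 - k) * cA G u k + cP G u k + (k + 1) * cA G u (k + 1)
      - cP G u (k + 1) := by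
    rw [hA, hA, hP, hP, Finset.mul_sum, Finset.mul_sum, ← Finset.sum_add_distrib,
      ← Finset.sum_add_distrib, ← Finset.sum_sub_distrib]
    refine Finset.sum_congr rfl fun x hx => ?_
    rw [T_inner, Finset.card_erase_of_mem hx, Finset.card_erase_of_mem (Finset.mem_univ _),
      Finset.card_univ, Nat.cast_sub (by omega), Nat.cast_sub (by omega)]
    push_cast
    ring
  rw [hrest]
  simp only [Finset.erase_idem, Finset.card_erase_of_mem (Finset.mem_univ u), Finset.card_univ,
    SimpleGraph.irrefl, if_false]
  rw [Nat.cast_sub (by omega)]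
  push_cast
  ring

lemma Sh.T (h : Sh G H u) (hn : 7 ≤ Fintype.card V) (k : ℕ) :
    (if dg G u = k then 1 else 0) * ((Fintype.card V : ℤ) - 1 - k) +
    (if dg G u = k + 1 then 1 else 0) * (k + 1) +
    ((Fintype.card V : ℤ) - 2 - k) * cA G u k + cP G u k + (k + 1) * cA G u (k + 1)
      - cP G u (k + 1) =
    (if dg H u = k then 1 else 0) * ((Fintype.card V : ℤ) - 1 - k) +
    (if dg H u = k + 1 then 1 else 0) * (k + 1) +
    ((Fintype.card V : ℤ) - 2 - k) * cA H u k + cP H u k + (k + 1) * cA H u (k + 1)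
      - cP H u (k + 1) := by
  rw [← T_eq hn, ← T_eq hn]
  refine Finset.sum_congr rfl fun v hv => ?_
  obtain ⟨σ, hs⟩ := h v (Finset.ne_of_mem_erase hv)
  exact hs.sum Finset.univ (by simp) (fun d => if d = k then 1 else 0)

/-- nonneighbours of `u` of degree `k` -/
noncomputable def cQ (G : SimpleGraph V) (u : V) (k : ℕ) : ℕ :=
  (Finset.univ.filter (fun x => (x ≠ u ∧ dg G x = k) ∧ ¬ G.Adj x u)).card

lemma cPQ (k : ℕ) : cP G u k + cQ G u k = cA G u k := by
  have := Finset.card_filter_add_card_filter_not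
    (s := Finset.univ.filter (fun x => x ≠ u ∧ dg G x = k)) (fun x => G.Adj x u)
  rw [Finset.filter_filter, Finset.filter_filter] at this
  exact this

lemma sum_cP (m : ℕ) : ∑ k ∈ Finset.range m, cP G u k ≤ dg G u := by
  have := Finset.sum_card_fiberwise_eq_card_filter (Finset.univ.filter (fun x => G.Adj u x))
    (Finset.range m) (fun x => dg G x)
  have h2 : ∀ k, cP G u k =
      ((Finset.univ.filter (fun x => G.Adj u x)).filter (fun x => dg G x = k)).card := by
    intro k
    unfold cP
    congr 1
    ext y
    simp only [Finset.mem_filter, Finset.mem_univ, true_and]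
    constructor
    · rintro ⟨a, b⟩; exact ⟨b.symm, a.2⟩
    · rintro ⟨a, b⟩; exact ⟨⟨a.ne', b⟩, a.symm⟩
  simp only [h2, this]
  exact Finset.card_filter_le _ _

lemma sum_cQ (m : ℕ) : ∑ k ∈ Finset.range m, cQ G u k + dg G u + 1 ≤ Fintype.card V := by
  have := Finset.sum_card_fiberwise_eq_card_filter
    (Finset.univ.filter (fun x => Gᶜ.Adj u x))
    (Finset.range m) (fun x => dg G x)
  have h2 : ∀ k, cQ G u k =
      ((Finset.univ.filter (fun x => Gᶜ.Adj u x)).filter (fun x => dg G x = k)).card := by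
    intro k
    unfold cQ
    congr 1
    ext y
    simp only [Finset.mem_filter, Finset.mem_univ, true_and, SimpleGraph.compl_adj]
    constructor
    · rintro ⟨a, b⟩; exact ⟨⟨a.1.symm, fun h => b h.symm⟩, a.2⟩
    · rintro ⟨a, b⟩; exact ⟨⟨a.1.symm, b⟩, fun h => a.2 h.symm⟩
  simp only [h2, this]
  rw [← dg_compl (G := G) u]
  have h3 : dg Gᶜ u = (Finset.univ.filter (fun y => Gᶜ.Adj u y)).card := by unfold dg; congr
  rw [h3]
  have := Finset.card_filter_le (Finset.univ.filter (fun x => Gᶜ.Adj u x))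
    (fun x => dg G x ∈ Finset.range m)
  omega

lemma cA_shift (hd : ∀ v, v ≠ u → dg G v = dg H v + 1) (k : ℕ) : cA H u k = cA G u (k + 1) := by
  unfold cA
  congr 1; ext x
  simp only [Finset.mem_filter, Finset.mem_univ, true_and]
  refine and_congr_right fun h => ?_
  rw [hd x h]; omega

lemma cA_zero (hd : ∀ v, v ≠ u → dg G v = dg H v + 1) : cA G u 0 = 0 := by
  unfold cA
  rw [Finset.card_eq_zero, Finset.filter_eq_empty_iff]
  rintro x - ⟨h, h2⟩
  rw [hd x h] at h2; omega
end
end CC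

namespace CC
section
open scoped Classical
variable {V : Type*} [Fintype V] {G H : SimpleGraph V} {u v : V} {σ : Equiv.Perm V}

set_option maxHeartbeats 1000000 in
lemma Sh.no_zero (h : Sh G H u) (hn : 7 ≤ Fintype.card V) (h0 : dg G u = 0)
    (h1 : dg H u + 3 = Fintype.card V) (hd : ∀ v, v ≠ u → dg G v = dg H v + 1) : False := by
  have t0 := h.T hn 0
  have t1 := h.T hn 1
  have t2 := h.T hn 2
  have t3 := h.T hn 3
  have t4 := h.T hn 4
  have a0 := cA_zero hd
  have sp := sum_cP (G := G) (u := u) 7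
  have sq := sum_cQ (G := H) (u := u) 7
  have pq0 := cPQ (G := H) (u := u) 0
  have pq1 := cPQ (G := H) (u := u) 1
  have pq2 := cPQ (G := H) (u := u) 2
  have pq3 := cPQ (G := H) (u := u) 3
  have pq4 := cPQ (G := H) (u := u) 4
  have pq5 := cPQ (G := H) (u := u) 5
  simp only [cA_shift hd, h0, Finset.sum_range_succ, Finset.sum_range_zero] at *
  obtain ⟨m, hm⟩ := Nat.exists_eq_add_of_le hn
  have e : dg H u = 4 + m := by omega
  clear hn h1 hd h
  clear h0
  generalize dg H u = dH at *
  generalize Fintype.card V = N at *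
  subst e hm
  generalize cA G u 0 = A0 at *
  generalize cA G u (0 + 1) = A1 at *
  generalize cA G u (1 + 1) = A2 at *
  generalize cA G u (2 + 1) = A3 at *
  generalize cA G u (3 + 1) = A4 at *
  generalize cA G u (4 + 1) = A5 at *
  generalize cA G u (5 + 1) = A6 at *
  simp only [Nat.reduceAdd] at *
  generalize cP G u 0 = p0 at *
  generalize cP G u 1 = p1 at *
  generalize cP G u 2 = p2 at *
  generalize cP G u 3 = p3 at *
  generalize cP G u 4 = p4 at *
  generalize cP G u 5 = p5 at *
  generalize cP G u 6 = p6 at *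
  generalize cP H u 0 = r0 at *
  generalize cP H u 1 = r1 at *
  generalize cP H u 2 = r2 at *
  generalize cP H u 3 = r3 at *
  generalize cP H u 4 = r4 at *
  generalize cP H u 5 = r5 at *
  generalize cQ H u 0 = q0 at *
  generalize cQ H u 1 = q1 at *
  generalize cQ H u 2 = q2 at *
  generalize cQ H u 3 = q3 at *
  generalize cQ H u 4 = q4 at *
  generalize cQ H u 5 = q5 at *
  generalize cQ H u 6 = q6 at *
  have : p0 = 0 ∧ p1 = 0 ∧ p2 = 0 ∧ p3 = 0 ∧ p4 = 0 ∧ p5 = 0 := by omega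
  obtain ⟨rfl, rfl, rfl, rfl, rfl, rfl⟩ := this
  subst a0
  have e0 : ((m : ℤ) + 5) * A1 = m + 6 + q0 - q1 := by
    have i1 : ¬ (4 + m = 0) := by omega
    have i2 : ¬ (4 + m = 1) := by omega
    simp only [i1, i2, if_true, if_false] at t0
    push_cast at t0
    zify at pq0 pq1
    simp at t0
    linear_combination -t0 - pq0 + pq1
  have hA1 : A1 = 1 := by
    have l1 : (A1 : ℤ) < 2 := lt_of_mul_lt_mul_left (a := (m : ℤ) + 5) (by omega) (by omega)
    have l2 : (0 : ℤ) < A1 := lt_of_mul_lt_mul_left (a := (m : ℤ) + 5) (by omega) (by omega)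
    omega
  subst hA1
  have hq : q0 = 0 ∧ q1 = 1 := by
    push_cast at e0; omega
  obtain ⟨rfl, rfl⟩ := hq
  have e1 : ((m : ℤ) + 4) * (1 - A2) + A2 - A3 + 1 - q2 = 0 := by
    have i1 : ¬ (4 + m = 1) := by omega
    have i2 : ¬ (4 + m = 2) := by omega
    simp [i1, i2] at t1
    zify at pq0 pq1 pq2
    linear_combination t1 + pq1 - pq2
  have hA2 : A2 = 1 := by
    have : (A2 : ℤ) < 2 := by
      have h5 : ((m : ℤ) + 4) * (1 - A2) = (m + 3) * 1 - (m + 3) * A2 + 1 - A2 := by ring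
      exact lt_of_mul_lt_mul_left (a := (m : ℤ) + 3) (by omega) (by omega)
    omega
  subst hA2
  have e2 : ((m : ℤ) + 3) * (1 - A3) + 2 * (A3 - A4) + q2 - q3 = 0 := by
    have i1 : ¬ (4 + m = 2) := by omega
    have i2 : ¬ (4 + m = 3) := by omega
    simp [i1, i2] at t2
    zify at pq0 pq1 pq2 pq3
    linear_combination t2 + pq2 - pq3
  clear t0 t1 t2
  have : (A3 = 1 ∧ q2 = 1) ∨ (A3 = 2 ∧ q2 = 0) := by push_cast at e1; clear t3 t4 e2; omega
  obtain ⟨rfl, rfl⟩ | ⟨rfl, rfl⟩ := this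
  · push_cast at e2; omega
  · push_cast at e2
    have : m = 1 ∧ A4 = 0 ∧ q3 = 0 := by clear t3 t4; omega
    obtain ⟨rfl, rfl, rfl⟩ := this
    simp at t3 t4
    omega

set_option maxHeartbeats 1000000 in
lemma Sh.one (h : Sh G H u) (hn : 7 ≤ Fintype.card V) (h0 : dg G u = 1)
    (h1 : dg H u + 2 = Fintype.card V) (hd : ∀ v, v ≠ u → dg G v = dg H v + 1) :
    Fintype.card V = 7 ∧ cQ H u 1 = 1 ∧
      ((cA G u 2 = 1 ∧ cA G u 3 = 3 ∧ cA G u 5 = 2) ∨ (cA G u 2 = 2 ∧ cA G u 4 = 3 ∧ cA G u 5 = 1)) := by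
  have t0 := h.T hn 0
  have t1 := h.T hn 1
  have t2 := h.T hn 2
  have t3 := h.T hn 3
  have t4 := h.T hn 4
  have a0 := cA_zero hd
  have sp := sum_cP (G := G) (u := u) 7
  have sq := sum_cQ (G := H) (u := u) 7
  have pq0 := cPQ (G := H) (u := u) 0
  have pq1 := cPQ (G := H) (u := u) 1
  have pq2 := cPQ (G := H) (u := u) 2
  have pq3 := cPQ (G := H) (u := u) 3
  have pq4 := cPQ (G := H) (u := u) 4
  have pq5 := cPQ (G := H) (u := u) 5
  have gq0 := cPQ (G := G) (u := u) 0
  have gq1 := cPQ (G := G) (u := u) 1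
  simp only [cA_shift hd, h0, Finset.sum_range_succ, Finset.sum_range_zero] at *
  obtain ⟨m, hm⟩ := Nat.exists_eq_add_of_le hn
  have e : dg H u = 5 + m := by omega
  clear hn h1 hd h
  clear h0
  generalize dg H u = dH at *
  generalize Fintype.card V = N at *
  subst e hm
  simp only [Nat.reduceAdd] at *
  generalize cA G u 0 = A0 at *
  generalize cA G u 1 = A1 at *
  generalize cA G u 2 = A2 at *
  generalize cA G u 3 = A3 at *
  generalize cA G u 4 = A4 at *
  generalize cA G u 5 = A5 at *
  generalize cA G u 6 = A6 at *
  generalize cP G u 0 = p0 at *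
  generalize cP G u 1 = p1 at *
  generalize cP G u 2 = p2 at *
  generalize cP G u 3 = p3 at *
  generalize cP G u 4 = p4 at *
  generalize cP G u 5 = p5 at *
  generalize cP G u 6 = p6 at *
  generalize cP H u 0 = r0 at *
  generalize cP H u 1 = r1 at *
  generalize cP H u 2 = r2 at *
  generalize cP H u 3 = r3 at *
  generalize cP H u 4 = r4 at *
  generalize cP H u 5 = r5 at *
  generalize cQ H u 0 = q0 at *
  generalize cQ H u 1 = q1 at *
  generalize cQ H u 2 = q2 at *
  generalize cQ H u 3 = q3 at *
  generalize cQ H u 4 = q4 at *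
  generalize cQ H u 5 = q5 at *
  generalize cQ H u 6 = q6 at *
  subst a0
  have hp0 : p0 = 0 := by omega
  subst hp0
  have e0 : ((m : ℤ) + 5) * A1 = 1 - p1 + q0 - q1 := by
    have i1 : ¬ (5 + m = 0) := by omega
    have i2 : ¬ (5 + m = 1) := by omega
    simp [i1, i2] at t0
    zify at pq0 pq1
    linear_combination -t0 - pq0 + pq1
  have hA1 : A1 = 0 := by
    have l1 : (A1 : ℤ) < 1 := lt_of_mul_lt_mul_left (a := (m : ℤ) + 5) (by omega) (by omega)
    omega
  subst hA1
  have hq : q0 = 0 ∧ q1 = 1 ∧ p1 = 0 ∧ q2 = 0 ∧ q3 = 0 ∧ q4 = 0 ∧ q5 = 0 := by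
    simp at e0; omega
  obtain ⟨rfl, rfl, rfl, rfl, rfl, rfl, rfl⟩ := hq
  have e1 : ((m : ℤ) + 3) * A2 + A3 + p2 = m + 6 := by
    have i1 : ¬ (5 + m = 1) := by omega
    have i2 : ¬ (5 + m = 2) := by omega
    simp [i1, i2] at t1
    zify at pq0 pq1 pq2
    linear_combination -t1 - pq1 + pq2
  have hA2 : A2 = 1 ∨ A2 = 2 := by
    have : (A2 : ℤ) < 3 := lt_of_mul_lt_mul_left (a := (m : ℤ) + 3) (by omega) (by omega)
    omega
  have e2 : ((m : ℤ) + 3) * (A2 - A3) + 2 * (A3 - A4) + p2 - p3 = 0 := by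
    have i1 : ¬ (5 + m = 2) := by omega
    have i2 : ¬ (5 + m = 3) := by omega
    simp [i1, i2] at t2
    zify at pq0 pq1 pq2 pq3
    linear_combination t2 + pq2 - pq3
  have e3 : ((m : ℤ) + 2) * (A3 - A4) + 3 * (A4 - A5) + p3 - p4 = 0 := by
    have i1 : ¬ (5 + m = 3) := by omega
    have i2 : ¬ (5 + m = 4) := by omega
    simp [i1, i2] at t3
    zify at pq3 pq4
    linear_combination t3 + pq3 - pq4
  clear t0 t1 t2 t3
  obtain rfl | rfl := hA2
  · have : (A3 = 2 ∧ p2 = 1) ∨ (A3 = 3 ∧ p2 = 0) := by push_cast at e1; omega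
    obtain ⟨rfl, rfl⟩ | ⟨rfl, rfl⟩ := this
    · push_cast at e2
      have : (m = 0 ∧ A4 = 1) ∨ (m = 2 ∧ A4 = 0) := by omega
      obtain ⟨rfl, rfl⟩ | ⟨rfl, rfl⟩ := this
      · push_cast at e3; omega
      · push_cast at e3; omega
    · push_cast at e2
      have : m = 0 ∧ A4 = 0 ∧ p3 = 0 := by omega
      obtain ⟨rfl, rfl, rfl⟩ := this
      push_cast at e3; omega
  · have : m = 0 ∧ A3 = 0 ∧ p2 = 0 := by push_cast at e1; omega
    obtain ⟨rfl, rfl, rfl⟩ := this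
    push_cast at e2 e3
    simp at t4
    omega

lemma Sh.no_B (h : Sh G H u) (hn : Fintype.card V = 7) (h0 : dg G u = 1)
    (h1 : dg H u = 5) (hd : ∀ v, v ≠ u → dg G v = dg H v + 1) (hq : cQ H u 1 = 1)
    (a2 : cA G u 2 = 1) (a3 : cA G u 3 = 3) (a5 : cA G u 5 = 2) : False := by
  have hall : ∀ x, x ≠ u → dg G x = 2 ∨ dg G x = 3 ∨ dg G x = 5 := by
    have h3 := Finset.sum_card_fiberwise_eq_card_filter (Finset.univ.erase u)
      ({2, 3, 5} : Finset ℕ) (fun x => dg G x)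
    have h2 : ∀ k, cA G u k = ((Finset.univ.erase u).filter (fun x => dg G x = k)).card := by
      intro k; unfold cA; congr 1; ext y; simp
    simp only [← h2] at h3
    have hc : (Finset.univ.erase u).card = 6 := by
      rw [Finset.card_erase_of_mem (Finset.mem_univ _), Finset.card_univ, hn]
    simp [a2, a3, a5] at h3
    have h4 := Finset.filter_card_eq (h3.symm.trans hc.symm)
    intro x hx
    simpa using h4 x (by simpa using hx)
  obtain ⟨z, hz⟩ := Finset.card_eq_one.1 hq
  have hz' : z ∈ Finset.univ.filter (fun x => (x ≠ u ∧ dg H x = 1) ∧ ¬ H.Adj x u) := by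
    rw [hz]; simp
  simp only [Finset.mem_filter, Finset.mem_univ, true_and] at hz'
  obtain ⟨⟨hzu, hz1⟩, hzn⟩ := hz'
  obtain ⟨y, hy⟩ := Finset.card_eq_one.1 a2
  have huniq : ∀ x, x ≠ u → dg G x = 2 → x = z := by
    have h1 : ∀ x, x ≠ u → dg G x = 2 → x = y := by
      intro x hx h2
      have : x ∈ Finset.univ.filter (fun x => x ≠ u ∧ dg G x = 2) := by simp [hx, h2]
      rw [hy] at this; simpa using this
    intro x hx h2
    rw [h1 x hx h2, h1 z hzu (by rw [hd z hzu, hz1])]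
  obtain ⟨σ, hs⟩ := h z hzu
  have hsu := hs.dc hzu.symm
  have b1 := dc_add (G := G) z u
  have b2 := dc_add (G := H) z (σ u)
  have hsz : σ u ≠ z := hs.ne.2 hzu.symm
  have hadj : H.Adj (σ u) z := by
    by_contra hc
    rw [if_neg hc] at b2
    by_cases hw : σ u = u
    · rw [hw] at b2 hsu; omega
    · have c1 := hall _ hw
      have c2 := hd _ hw
      have c3 := huniq _ hw
      by_cases c4 : dg G (σ u) = 2
      · exact hsz (c3 c4)
      · omega
  have hd2 : dg H (σ u) ≤ 2 := by split_ifs at b2 <;> omega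
  have honly : ∀ x, H.Adj x z → x = σ u := by
    intro x hx
    obtain ⟨t, ht⟩ := Finset.card_eq_one.1 hz1
    have m1 : x ∈ Finset.univ.filter (fun y => H.Adj z y) := by simpa using hx.symm
    have m2 : σ u ∈ Finset.univ.filter (fun y => H.Adj z y) := by simpa using hadj.symm
    rw [ht] at m1 m2
    simp at m1 m2; rw [m1, m2]
  have hsum := hs.sum Finset.univ (by simp) (fun d => if 4 ≤ d then 1 else 0)
  rw [Finset.sum_boole, Finset.sum_boole] at hsum
  have hG : ((Finset.univ.erase z).filter (fun x => 4 ≤ dc G z x)).card ≤ cA G u 5 := by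
    refine Finset.card_le_card ?_
    intro x hx
    simp only [Finset.mem_filter, Finset.mem_univ, true_and] at hx ⊢
    have c1 := dc_add (G := G) z x
    have hxu : x ≠ u := by rintro rfl; omega
    have := hall x hxu
    refine ⟨hxu, by omega⟩
  have hH : cA G u 5 + 1 ≤ ((Finset.univ.erase z).filter (fun x => 4 ≤ dc H z x)).card := by
    unfold cA
    rw [← Finset.card_insert_of_notMem (a := u) (by simp)]
    refine Finset.card_le_card ?_
    intro x hx
    simp only [Finset.mem_insert, Finset.mem_filter, Finset.mem_univ, true_and, Finset.mem_erase, and_true] at hx ⊢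
    have c1 := dc_add (G := H) z x
    have hx4 : 4 ≤ dg H x ∧ x ≠ z := by
      obtain rfl | ⟨c, c'⟩ := hx
      · exact ⟨by omega, hzu.symm⟩
      · have := hd x c
        refine ⟨by omega, ?_⟩
        rintro rfl; omega
    refine ⟨hx4.2, ?_⟩
    have : ¬ H.Adj x z := by
      intro hc
      rw [honly x hc] at hx4
      omega
    rw [if_neg this] at c1
    omega
  have : ((Finset.univ.erase z).filter (fun x => 4 ≤ dc G z x)).card = ((Finset.univ.erase z).filter (fun x => 4 ≤ dc H z x)).card := by
    exact_mod_cast hsum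
  omega

lemma Sh.no_one (h : Sh G H u) (hn : 7 ≤ Fintype.card V)
    (h1 : dg H u + 3 = Fintype.card V + dg G u) (hd : ∀ v, v ≠ u → dg G v = dg H v + 1) :
    False := by
  have hc := h.symm.compl
  have hdc : ∀ v, v ≠ u → dg Hᶜ v = dg Gᶜ v + 1 := by
    intro v hv
    have := hd v hv
    have := dg_compl (G := G) v
    have := dg_compl (G := H) v
    omega
  have cu := dg_compl (G := G) u
  have cu' := dg_compl (G := H) u
  have lt := dg_lt (G := H) u
  have : dg G u = 0 ∨ dg G u = 1 ∨ dg G u = 2 := by omega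
  obtain h0 | h0 | h0 := this
  · exact h.no_zero hn h0 (by omega) hd
  · obtain ⟨c7, hq, ha⟩ := h.one hn h0 (by omega) hd
    obtain ⟨-, hq', ha'⟩ := hc.one hn (by omega) (by omega) hdc
    obtain ⟨x1, x2, x3⟩ | ⟨x1, x2, x3⟩ := ha
    · exact h.no_B c7 h0 (by omega) hd hq x1 x2 x3
    obtain ⟨y1, y2, y3⟩ | ⟨y1, y2, y3⟩ := ha'
    · exact hc.no_B c7 (by omega) (by omega) hdc hq' y1 y2 y3
    have : cA Hᶜ u 2 = cA G u 5 := by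
      unfold cA
      congr 1; ext x
      simp only [Finset.mem_filter, Finset.mem_univ, true_and]
      refine and_congr_right fun h => ?_
      have := hd x h
      have := dg_compl (G := H) x
      omega
    omega
  · exact hc.no_zero hn (by omega) (by omega) hdc

lemma Sh.deg_eq (h : Sh G H u) (hn : 7 ≤ Fintype.card V) (v : V) : dg G v = dg H v := by
  obtain ⟨e, he, hu, hv⟩ := h.eps hn
  obtain rfl | rfl | rfl := he
  · by_cases hvu : v = u
    · subst hvu; simp at hu; omega
    · have := hv v hvu; omega
  · exact (h.no_one hn (by omega) (fun x hx => by have := hv x hx; omega)).elim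
  · exact (h.symm.no_one hn (by omega) (fun x hx => by have := hv x hx; omega)).elim
end
end CC

namespace CC
section
open scoped Classical
variable {V : Type*} [Fintype V] {G H : SimpleGraph V} {u v : V} {σ : Equiv.Perm V} {M : Finset V}

/-- `r`-cliques meeting `M` in exactly `t` vertices -/
noncomputable def cl (G : SimpleGraph V) (M : Finset V) (r t : ℕ) : Finset (Finset V) :=
  Finset.univ.filter (fun s => G.IsNClique r s ∧ (s ∩ M).card = t)

/-- those avoiding `v` -/
noncomputable def clv (G : SimpleGraph V) (M : Finset V) (r t : ℕ) (v : V) : Finset (Finset V) :=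
  (cl G M r t).filter (fun s => v ∉ s)

lemma mem_cl {r t : ℕ} {s : Finset V} : s ∈ cl G M r t ↔ G.IsNClique r s ∧ (s ∩ M).card = t := by
  simp [cl]

lemma clv_le (h : IsoAt G H v σ) (hM : ∀ x, x ∈ M ↔ σ x ∈ M) (r t : ℕ) :
    (clv G M r t v).card ≤ (clv H M r t v).card := by
  refine Finset.card_le_card_of_injOn (fun s => s.map σ.toEmbedding) ?_ ?_
  · intro s hs
    simp only [clv, Finset.coe_filter, Set.mem_setOf_eq, mem_cl] at hs ⊢
    obtain ⟨⟨hc, ht⟩, hv⟩ := hs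
    have hv' : ∀ x ∈ s, x ≠ v := by rintro x hx rfl; exact hv hx
    refine ⟨⟨?_, ?_⟩, ?_⟩
    · rw [SimpleGraph.isNClique_iff] at hc ⊢
      refine ⟨?_, by rw [Finset.card_map]; exact hc.2⟩
      intro a ha b hb hab
      simp only [Finset.coe_map, Set.mem_image] at ha hb
      obtain ⟨x, hx, rfl⟩ := ha
      obtain ⟨y, hy, rfl⟩ := hb
      refine (h.2 x y (hv' x hx) (hv' y hy)).1 (hc.1 hx hy ?_)
      rintro rfl; exact hab rfl
    · rw [← ht, ← Finset.card_map σ.toEmbedding (s := s ∩ M)]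
      congr 1
      ext y
      simp only [Finset.mem_inter, Finset.mem_map]
      constructor
      · rintro ⟨⟨x, hx, rfl⟩, hy⟩; exact ⟨x, ⟨hx, (hM x).2 hy⟩, rfl⟩
      · rintro ⟨x, ⟨hx, hxm⟩, rfl⟩; exact ⟨⟨x, hx, rfl⟩, (hM x).1 hxm⟩
    · simp only [Finset.mem_map, not_exists, not_and]
      intro x hx; exact h.ne.2 (hv' x hx)
  · intro a _ b _ hab
    exact Finset.map_injective _ hab

lemma clv_eq (h : IsoAt G H v σ) (hM : ∀ x, x ∈ M ↔ σ x ∈ M) (r t : ℕ) :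
    (clv G M r t v).card = (clv H M r t v).card := by
  refine le_antisymm (clv_le h hM r t) (clv_le h.symm ?_ r t)
  intro x; rw [hM (σ.symm x)]; simp

lemma sum_clv (N : Finset V) (r t : ℕ) :
    ∑ v ∈ N, (clv G M r t v).card = ∑ s ∈ cl G M r t, (N \ s).card := by
  simp only [clv, Finset.card_filter, Finset.sdiff_eq_filter]
  exact Finset.sum_comm

lemma mN_transfer (h : IsoAt G H v σ) (hM : ∀ x, x ∈ M ↔ σ x ∈ M)
    (hd : ∀ x, dg G x = dg H x) : mN G M v = mN H M v := by
  have h1 := h.sum M hM (fun k => (k : ℤ))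
  have h2 := sum_dc (G := G) (v := v) M
  have h3 := sum_dc (G := H) (v := v) M
  simp only [hd] at h2
  omega

lemma sum_mN : ∑ v, mN G M v = ∑ x ∈ M, dg G x := by
  simp only [mN, dg, Finset.card_filter]
  rw [Finset.sum_comm]
  simp only [SimpleGraph.adj_comm]

lemma mN_full : mN G M v = M.card ↔ ∀ y ∈ M, G.Adj v y := by
  unfold mN
  rw [Finset.card_filter_eq_iff]

lemma clique_iff (M : Finset V) : G.IsClique (M : Set V) ↔ ∀ x ∈ M, mN G M x + 1 = M.card := by
  have key : ∀ x ∈ M, (mN G M x + 1 = M.card ↔ ∀ y ∈ M.erase x, G.Adj x y) := by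
    intro x hx
    have h1 : mN G M x = ((M.erase x).filter (fun y => G.Adj x y)).card := by
      unfold mN; congr 1; ext y; simp only [Finset.mem_filter, Finset.mem_erase]
      constructor
      · rintro ⟨a, b⟩; exact ⟨⟨b.ne', a⟩, b⟩
      · rintro ⟨a, b⟩; exact ⟨a.2, b⟩
    rw [← Finset.card_filter_eq_iff, ← h1, ← Finset.card_erase_add_one hx]
    omega
  constructor
  · intro h x hx
    rw [key x hx]
    intro y hy
    rw [Finset.mem_erase] at hy
    exact h hx hy.2 hy.1.symm
  · intro h x hx y hy hxy
    exact (key x hx).1 (h x hx) y (Finset.mem_erase.2 ⟨hxy.symm, hy⟩)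

/-- cliques containing `M` -/
lemma cl_full (hc : G.IsClique (M : Set V)) (r : ℕ) :
    (cl G M (r + M.card) M.card).card =
      ((cl G M r 0).filter (fun s => ∀ x ∈ s, mN G M x = M.card)).card := by
  refine Finset.card_bij (fun s _ => s \ M) ?_ ?_ ?_
  · intro s hs
    rw [mem_cl, SimpleGraph.isNClique_iff] at hs
    have hsub : M ⊆ s := by
      have := Finset.eq_of_subset_of_card_le (Finset.inter_subset_right : s ∩ M ⊆ M) hs.2.ge
      rw [← this]; exact Finset.inter_subset_left
    simp only [Finset.mem_filter, mem_cl, SimpleGraph.isNClique_iff]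
    refine ⟨⟨⟨hs.1.1.subset ?_, ?_⟩, ?_⟩, ?_⟩
    · exact_mod_cast Finset.sdiff_subset
    · have := Finset.card_sdiff_add_card_eq_card hsub
      omega
    · rw [Finset.sdiff_inter_self]; rfl
    · intro x hx
      rw [Finset.mem_sdiff] at hx
      rw [mN_full]
      intro y hy
      refine hs.1.1 hx.1 (hsub hy) ?_
      rintro rfl; exact hx.2 hy
  · intro a ha b hb hab
    have hsub : ∀ s ∈ cl G M (r + M.card) M.card, M ⊆ s := by
      intro s hs
      rw [mem_cl] at hs
      have := Finset.eq_of_subset_of_card_le (Finset.inter_subset_right : s ∩ M ⊆ M) hs.2.ge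
      rw [← this]; exact Finset.inter_subset_left
    rw [← Finset.sdiff_union_of_subset (hsub a ha), ← Finset.sdiff_union_of_subset (hsub b hb)]
    rw [hab]
  · intro s hs
    simp only [Finset.mem_filter, mem_cl, SimpleGraph.isNClique_iff] at hs
    obtain ⟨⟨⟨h1, h2⟩, h3⟩, h4⟩ := hs
    rw [Finset.card_eq_zero] at h3
    have hdis : Disjoint s M := Finset.disjoint_iff_inter_eq_empty.2 h3
    refine ⟨s ∪ M, ?_, ?_⟩
    · rw [mem_cl, SimpleGraph.isNClique_iff]
      refine ⟨⟨?_, ?_⟩, ?_⟩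
      · intro x hx y hy hxy
        simp only [Finset.coe_union, Set.mem_union, Finset.mem_coe] at hx hy
        obtain hx | hx := hx <;> obtain hy | hy := hy
        · exact h1 hx hy hxy
        · exact mN_full.1 (h4 x hx) y hy
        · exact (mN_full.1 (h4 y hy) x hx).symm
        · exact hc hx hy hxy
      · rw [Finset.card_union_of_disjoint hdis, h2]
      · rw [Finset.inter_eq_right.2 Finset.subset_union_right]
    · rw [Finset.union_sdiff_cancel_right hdis]

lemma cl_empty {r t : ℕ} (h : M.card < t) : cl G M r t = ∅ := by
  rw [Finset.eq_empty_iff_forall_notMem]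
  intro s hs
  rw [mem_cl] at hs
  have := Finset.card_le_card (Finset.inter_subset_right : s ∩ M ⊆ M)
  omega

lemma cl_empty' {r : ℕ} (h : ¬ (G.IsClique (M : Set V) ∧ M.card ≤ r)) :
    cl G M r M.card = ∅ := by
  rw [Finset.eq_empty_iff_forall_notMem]
  intro s hs
  rw [mem_cl, SimpleGraph.isNClique_iff] at hs
  have hsub : M ⊆ s := by
    have := Finset.eq_of_subset_of_card_le (Finset.inter_subset_right : s ∩ M ⊆ M) hs.2.ge
    rw [← this]; exact Finset.inter_subset_left
  refine h ⟨hs.1.1.subset (by exact_mod_cast hsub), ?_⟩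
  rw [← hs.1.2]; exact Finset.card_le_card hsub

lemma clv_all {r : ℕ} (hv : v ∉ M) (hm : mN G M v ≠ M.card) :
    clv G M r M.card v = cl G M r M.card := by
  unfold clv
  rw [Finset.filter_eq_self]
  intro s hs hvs
  rw [mem_cl, SimpleGraph.isNClique_iff] at hs
  have hsub : M ⊆ s := by
    have := Finset.eq_of_subset_of_card_le (Finset.inter_subset_right : s ∩ M ⊆ M) hs.2.ge
    rw [← this]; exact Finset.inter_subset_left
  refine hm (mN_full.2 fun y hy => hs.1.1 hvs (hsub hy) ?_)
  rintro rfl; exact hv hy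

theorem cl_eq (h : ∀ v, v ≠ u → ∃ σ : Equiv.Perm V, IsoAt G H v σ ∧ ∀ x, x ∈ M ↔ σ x ∈ M)
    (hu : u ∉ M) (hne : M.Nonempty) (hd : ∀ x, dg G x = dg H x) (r t : ℕ) :
    (cl G M r t).card = (cl H M r t).card := by
  have hclv : ∀ r t v, v ≠ u → (clv G M r t v).card = (clv H M r t v).card := by
    intro r t v hv
    obtain ⟨σ, hs, hM⟩ := h v hv
    exact clv_eq hs hM r t
  -- the easy case
  have easy : ∀ r t, t ≠ M.card → (cl G M r t).card = (cl H M r t).card := by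
    intro r t ht
    rcases lt_or_gt_of_ne ht with hlt | hgt
    · have hsum : ∑ v ∈ M, (clv G M r t v).card = ∑ v ∈ M, (clv H M r t v).card :=
        Finset.sum_congr rfl fun v hv => hclv r t v (by rintro rfl; exact hu hv)
      have hs : ∀ K : SimpleGraph V, ∑ v ∈ M, (clv K M r t v).card =
          (cl K M r t).card * (M.card - t) := by
        intro K
        rw [sum_clv, Finset.sum_const_nat]
        intro s hs
        rw [mem_cl] at hs
        rw [Finset.card_sdiff, hs.2]
      rw [hs, hs] at hsum
      exact Nat.eq_of_mul_eq_mul_right (by omega) hsum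
    · rw [cl_empty hgt, cl_empty hgt]
  by_cases ht : t = M.card
  swap
  · exact easy r t ht
  subst ht
  have hm : ∀ v, v ≠ u → mN G M v = mN H M v := by
    intro v hv
    obtain ⟨σ, hs, hM⟩ := h v hv
    exact mN_transfer hs hM hd
  have hmu : mN G M u = mN H M u := by
    have h1 : ∑ v, mN G M v = ∑ v, mN H M v := by
      rw [sum_mN, sum_mN]; simp only [hd]
    have h2 := Finset.sum_erase_add _ (fun v => mN G M v) (Finset.mem_univ u)
    have h3 := Finset.sum_erase_add _ (fun v => mN H M v) (Finset.mem_univ u)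
    have h4 : ∑ v ∈ Finset.univ.erase u, mN G M v = ∑ v ∈ Finset.univ.erase u, mN H M v :=
      Finset.sum_congr rfl fun v hv => hm v (Finset.ne_of_mem_erase hv)
    beta_reduce at h2 h3
    rw [h4, h1, ← h3] at h2
    exact Nat.add_left_cancel h2
  have hmall : ∀ v, mN G M v = mN H M v := by
    intro v; by_cases hv : v = u
    · rw [hv, hmu]
    · exact hm v hv
  by_cases hex : ∃ v, v ∉ M ∧ v ≠ u ∧ mN G M v ≠ M.card
  · obtain ⟨v, hv, hvu, hvm⟩ := hex
    rw [← clv_all hv hvm, ← clv_all (G := H) hv (by rwa [← hmall]), hclv _ _ _ hvu]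
  push Not at hex
  have hciff : G.IsClique (M : Set V) ↔ H.IsClique (M : Set V) := by
    rw [clique_iff, clique_iff]; simp only [hmall]
  by_cases hc : G.IsClique (M : Set V) ∧ M.card ≤ r
  swap
  · rw [cl_empty' hc, cl_empty' (by rwa [← hciff])]
  obtain ⟨hc, hr⟩ := hc
  obtain ⟨q, rfl⟩ := Nat.exists_eq_add_of_le' hr
  rw [cl_full hc, cl_full (hciff.1 hc)]
  have h0 : (cl G M q 0).card = (cl H M q 0).card := easy q 0 hne.card_pos.ne
  have hnot : ∀ (K : SimpleGraph V), ∀ s ∈ cl K M q 0, ∀ x ∈ s, x ∉ M := by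
    intro K s hs x hx hxm
    rw [mem_cl, Finset.card_eq_zero] at hs
    have : x ∈ s ∩ M := Finset.mem_inter.2 ⟨hx, hxm⟩
    rw [hs.2] at this; simp at this
  by_cases hfu : mN G M u = M.card
  · have hf : ∀ x, x ∉ M → mN G M x = M.card := by
      intro x hx; by_cases hxu : x = u
      · rw [hxu, hfu]
      · exact hex x hx hxu
    rw [Finset.filter_true_of_mem, Finset.filter_true_of_mem, h0]
    · intro s hs x hx; rw [← hmall]; exact hf x (hnot _ s hs x hx)
    · intro s hs x hx; exact hf x (hnot _ s hs x hx)
  · have hcu : (clv G M q 0 u).card = (clv H M q 0 u).card := by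
      have hs : ∀ K : SimpleGraph V, ∑ v, (clv K M q 0 v).card =
          (cl K M q 0).card * (Fintype.card V - q) := by
        intro K
        rw [sum_clv, Finset.sum_const_nat]
        intro s hs
        rw [mem_cl, SimpleGraph.isNClique_iff] at hs
        rw [← Finset.compl_eq_univ_sdiff, Finset.card_compl, hs.1.2]
      have h1 : ∑ v, (clv G M q 0 v).card = ∑ v, (clv H M q 0 v).card := by
        rw [hs, hs, h0]
      have h2 := Finset.sum_erase_add _ (fun v => (clv G M q 0 v).card) (Finset.mem_univ u)
      have h3 := Finset.sum_erase_add _ (fun v => (clv H M q 0 v).card) (Finset.mem_univ u)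
      rw [Finset.sum_congr rfl fun v hv => hclv _ _ v (Finset.ne_of_mem_erase hv)] at h2
      omega
    have hfin : ∀ K : SimpleGraph V, (∀ x, mN G M x = mN K M x) →
        (cl K M q 0).filter (fun s => ∀ x ∈ s, mN K M x = M.card) = clv K M q 0 u := by
      intro K hK
      unfold clv
      refine Finset.filter_congr fun s hs => ?_
      constructor
      · intro hx hus
        exact hfu ((hK u).trans (hx u hus))
      · intro hus x hx
        rw [← hK]
        exact hex x (hnot K s hs x hx) (by rintro rfl; exact hus hx)
    rw [hfin G (fun _ => rfl), hfin H hmall, hcu]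

theorem main (h : Sh G H u) (hn : 7 ≤ Fintype.card V) (a : ℕ) (ha : ∀ v, dg G v ≠ a)
    (hlo : ∃ v, dg G v < a) (hhi : ∃ v, a < dg G v) (r : ℕ) :
    kappa G r = kappa H r := by
  have hd : ∀ x, dg G x = dg H x := h.deg_eq hn
  have hpres : ∀ v, v ≠ u → ∃ σ : Equiv.Perm V, IsoAt G H v σ ∧
      ∀ x, a < dg G x ↔ a < dg G (σ x) := by
    intro v hv
    obtain ⟨σ, hs⟩ := h v hv
    refine ⟨σ, hs, fun x => ?_⟩
    by_cases hx : x = v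
    · rw [hx, hs.1]
    · have h1 := dc_add (G := G) v x
      have h2 := dc_add (G := H) v (σ x)
      have h3 := hs.dc hx
      have h4 := ha x
      have h5 := ha (σ x)
      rw [← hd] at h2
      split_ifs at h1 h2 <;> omega
  have hk : ∀ (K : SimpleGraph V) (M : Finset V), kappa K r =
      ∑ t ∈ Finset.range (r + 1), (cl K M r t).card := by
    intro K M
    have e : K.cliqueSet r = ((Finset.univ.filter (fun s => K.IsNClique r s) : Finset (Finset V)) : Set (Finset V)) := by
      ext s; simp
    unfold kappa
    rw [e, Set.ncard_coe_finset,
      Finset.card_eq_sum_card_fiberwise (f := fun s => (s ∩ M).card) (t := Finset.range (r + 1))]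
    · refine Finset.sum_congr rfl fun t _ => ?_
      unfold cl; rw [Finset.filter_filter]
    · intro s hs
      simp only [Finset.coe_filter, Finset.mem_univ, true_and, Set.mem_setOf_eq] at hs
      have := Finset.card_le_card (Finset.inter_subset_left : s ∩ M ⊆ s)
      rw [hs.card_eq] at this
      simp; omega
  by_cases hu : a < dg G u
  · set M : Finset V := Finset.univ.filter (fun x => ¬ a < dg G x) with hM
    rw [hk G M, hk H M]
    refine Finset.sum_congr rfl fun t _ => cl_eq (u := u) ?_ (by simp [hM, hu]) ?_ hd r t
    · intro v hv
      obtain ⟨σ, hs, hp⟩ := hpres v hv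
      exact ⟨σ, hs, fun x => by simp only [hM, Finset.mem_filter, Finset.mem_univ, true_and, hp x]⟩
    · obtain ⟨v, hv⟩ := hlo
      exact ⟨v, by simp [hM]; omega⟩
  · set M : Finset V := Finset.univ.filter (fun x => a < dg G x) with hM
    rw [hk G M, hk H M]
    refine Finset.sum_congr rfl fun t _ => cl_eq (u := u) ?_ (by simp [hM]; omega) ?_ hd r t
    · intro v hv
      obtain ⟨σ, hs, hp⟩ := hpres v hv
      exact ⟨σ, hs, fun x => by simp only [hM, Finset.mem_filter, Finset.mem_univ, true_and, hp x]⟩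
    · obtain ⟨v, hv⟩ := hhi
      exact ⟨v, by simp [hM]; omega⟩

/-- extend a bijection of punctured sets -/
lemma extend_equiv {a b : V} (e : {x : V // x ≠ a} ≃ {x : V // x ≠ b}) :
    ∃ σ : Equiv.Perm V, σ a = b ∧ ∀ x : {x : V // x ≠ a}, σ x = e x := by
  have hb : ∃ f : V → V, f a = b ∧ ∀ x : {x : V // x ≠ a}, f x = e x :=
    ⟨fun x => if hx : x = a then b else e ⟨x, hx⟩, by simp, fun x => by simp [x.2]⟩
  obtain ⟨f, h1, h2⟩ := hb
  have hinj : Function.Injective f := by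
    intro x y hxy
    by_cases hx : x = a <;> by_cases hy : y = a
    · rw [hx, hy]
    · rw [hx, h1, h2 ⟨y, hy⟩] at hxy; exact ((e ⟨y, hy⟩).2 hxy.symm).elim
    · rw [hy, h1, h2 ⟨x, hx⟩] at hxy; exact ((e ⟨x, hx⟩).2 hxy).elim
    · rw [h2 ⟨x, hx⟩, h2 ⟨y, hy⟩] at hxy
      have := e.injective (Subtype.ext hxy)
      exact congrArg Subtype.val this
  exact ⟨Equiv.ofBijective f (Finite.injective_iff_bijective.1 hinj), h1, h2⟩

lemma kappa_comap (p : Equiv.Perm V) (r : ℕ) : kappa (H.comap p) r = kappa H r := by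
  unfold kappa
  refine Set.ncard_congr (fun s _ => s.map p.toEmbedding) ?_ ?_ ?_
  · intro s hs
    rw [SimpleGraph.mem_cliqueSet_iff, SimpleGraph.isNClique_iff] at hs ⊢
    refine ⟨?_, by rw [Finset.card_map]; exact hs.2⟩
    intro a ha b hb hab
    simp only [Finset.coe_map, Set.mem_image] at ha hb
    obtain ⟨x, hx, rfl⟩ := ha
    obtain ⟨y, hy, rfl⟩ := hb
    exact hs.1 hx hy (by rintro rfl; exact hab rfl)
  · intro a b _ _ hab; exact Finset.map_injective _ hab
  · intro s hs
    refine ⟨s.map p.symm.toEmbedding, ?_, ?_⟩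
    · rw [SimpleGraph.mem_cliqueSet_iff, SimpleGraph.isNClique_iff] at hs ⊢
      refine ⟨?_, by rw [Finset.card_map]; exact hs.2⟩
      intro a ha b hb hab
      simp only [Finset.coe_map, Set.mem_image] at ha hb
      obtain ⟨x, hx, rfl⟩ := ha
      obtain ⟨y, hy, rfl⟩ := hb
      simp only [SimpleGraph.comap_adj, Equiv.coe_toEmbedding, Equiv.apply_symm_apply]
      exact hs.1 hx hy (by rintro rfl; exact hab rfl)
    · ext x; simp

lemma deg_eq_dg (x : V) : deg G x = dg G x := by
  unfold deg dg
  rw [← Set.ncard_coe_finset]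
  congr 1; ext y; simp

lemma share_norm {w : V} (π : {x : V // x ≠ u} ≃ {y : V // y ≠ w})
    (h : ∀ v : {x : V // x ≠ u}, Nonempty (gcard G v.1 ≃g gcard H (π v).1)) :
    ∃ p : Equiv.Perm V, Sh G (H.comap p) u := by
  obtain ⟨p, hp, hp'⟩ := extend_equiv π
  refine ⟨p, fun v hv => ?_⟩
  obtain ⟨φ⟩ := h ⟨v, hv⟩
  obtain ⟨τ, ht, ht'⟩ := extend_equiv φ.toEquiv
  refine ⟨τ.trans p.symm, ?_, ?_⟩
  · simp only [Equiv.trans_apply, ht, ← hp' ⟨v, hv⟩, Equiv.symm_apply_apply]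
  · intro x y hx hy
    simp only [Equiv.trans_apply, SimpleGraph.comap_adj, Equiv.apply_symm_apply]
    rw [ht' ⟨x, hx⟩, ht' ⟨y, hy⟩]
    have := φ.map_rel_iff (a := ⟨x, hx⟩) (b := ⟨y, hy⟩)
    exact this.symm
end
end CC

theorem clique_count_of_degree_hole {n : ℕ} (hn : 7 ≤ n)
    (G H : SimpleGraph (Fin n)) (hshare : ShareCards G H)
    (hhole : ∃ a : ℕ, minDeg G < a ∧ a < maxDeg G ∧ ∀ v : Fin n, deg G v ≠ a) :
    ∀ r : ℕ, 1 ≤ r → kappa G r = kappa H r := by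
  intro r _
  obtain ⟨u, w, π, h⟩ := hshare
  obtain ⟨a, hlo, hhi, ha⟩ := hhole
  obtain ⟨p, hp⟩ := CC.share_norm π h
  rw [← CC.kappa_comap (H := H) p]
  refine CC.main hp (by simpa using hn) a (fun v => by rw [← CC.deg_eq_dg]; exact ha v) ?_ ?_ r
  · have hne : (Set.range (fun v => deg G v)).Nonempty := ⟨_, u, rfl⟩
    obtain ⟨v, hv⟩ := Nat.sInf_mem hne
    refine ⟨v, ?_⟩
    rw [← CC.deg_eq_dg]
    have : deg G v = minDeg G := hv
    omega
  · unfold maxDeg at hhi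
    rw [Finset.lt_sup_iff] at hhi
    obtain ⟨v, -, hv⟩ := hhi
    exact ⟨v, by rw [← CC.deg_eq_dg]; exact hv⟩
end

section
/- Let n ≥ 7 and let G and H be simple graphs on n vertices that share n−1 cards. If Δ(G) ≤ n/2 − 1 (equivalently, 2·Δ(G) + 2 ≤ n), then for every integer r ≥ 1 we have κ_r(G) = κ_r(H). -/
open SimpleGraph


/-- closed neighbourhood -/
noncomputable def cN {n : ℕ} (G : SimpleGraph (Fin n)) (x : Fin n) : Finset (Fin n) :=
  open Classical in Finset.univ.filter (fun z => z = x ∨ G.Adj x z)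

/-- degree as a finset cardinality -/
noncomputable def dg {n : ℕ} (G : SimpleGraph (Fin n)) (x : Fin n) : ℕ :=
  open Classical in (Finset.univ.filter (fun z => G.Adj x z)).card

/-- degree in the card -/
noncomputable def dgc {n : ℕ} (G : SimpleGraph (Fin n)) (x y : Fin n) : ℕ :=
  open Classical in (Finset.univ.filter (fun z => z ≠ y ∧ G.Adj x z)).card

/-- the finset of `r`-cliques -/
noncomputable def cQ {n : ℕ} (G : SimpleGraph (Fin n)) (r : ℕ) : Finset (Finset (Fin n)) :=
  open Classical in Finset.univ.filter (fun Q => G.IsNClique r Q)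

/-- number of `r`-cliques through `x` -/
noncomputable def dr {n : ℕ} (G : SimpleGraph (Fin n)) (r : ℕ) (x : Fin n) : ℕ :=
  ((cQ G r).filter (fun Q => x ∈ Q)).card

/-- number of `r`-cliques through `x` avoiding `y` -/
noncomputable def dd {n : ℕ} (G : SimpleGraph (Fin n)) (r : ℕ) (x y : Fin n) : ℕ :=
  ((cQ G r).filter (fun Q => x ∈ Q ∧ y ∉ Q)).card

/-- local isomorphism of cards, extended to a permutation -/
def LI {n : ℕ} (G H : SimpleGraph (Fin n)) (y y' : Fin n) (σ : Equiv.Perm (Fin n)) : Prop :=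
  σ y = y' ∧ ∀ a b, a ≠ y → b ≠ y → (G.Adj a b ↔ H.Adj (σ a) (σ b))

/-- sharing of cards through a permutation -/
def Sh {n : ℕ} (G H : SimpleGraph (Fin n)) (p : Equiv.Perm (Fin n)) (u : Fin n) : Prop :=
  ∀ y, y ≠ u → ∃ σ, LI G H y (p y) σ

section
variable {n : ℕ} {G H : SimpleGraph (Fin n)}

lemma LI.symm {y y' : Fin n} {σ : Equiv.Perm (Fin n)} (h : LI G H y y' σ) :
    LI H G y' y σ.symm := by
  obtain ⟨h1, h2⟩ := h
  refine ⟨by rw [← h1]; simp, fun a b ha hb => ?_⟩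
  have := h2 (σ.symm a) (σ.symm b) (by rintro h; apply ha; rw [← h1, ← h]; simp)
    (by rintro h; apply hb; rw [← h1, ← h]; simp)
  simpa using this.symm

lemma Sh.symm {p : Equiv.Perm (Fin n)} {u : Fin n} (h : Sh G H p u) :
    Sh H G p.symm (p u) := by
  intro y hy
  obtain ⟨σ, hσ⟩ := h (p.symm y) (by rintro h; apply hy; rw [← h]; simp)
  refine ⟨σ.symm, ?_⟩
  have := hσ.symm
  simpa using this

lemma ShareCards.sh (h : ShareCards G H) : ∃ p u, Sh G H p u := by
  classical
  obtain ⟨u, w, π, h⟩ := h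
  let ext : ∀ {a b : Fin n} (e : {x : Fin n // x ≠ a} ≃ {x : Fin n // x ≠ b}),
      ∃ q : Equiv.Perm (Fin n), q a = b ∧ ∀ x : {x : Fin n // x ≠ a}, q x.1 = (e x).1 := by
    intro a b e
    refine ⟨(Equiv.optionSubtypeNe a).symm.trans
      ((Equiv.optionCongr e).trans (Equiv.optionSubtypeNe b)), ?_, ?_⟩
    · simp
    · intro x
      simp [Equiv.optionSubtypeNe_symm_of_ne x.2]
  obtain ⟨p, hp, hp'⟩ := ext π
  refine ⟨p, u, fun y hy => ?_⟩
  obtain ⟨φ⟩ := h ⟨y, hy⟩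
  obtain ⟨σ, hσ, hσ'⟩ := ext φ.toEquiv
  refine ⟨σ, ?_, ?_⟩
  · rw [hσ, hp' ⟨y, hy⟩]
  · intro a b ha hb
    rw [hσ' ⟨a, ha⟩, hσ' ⟨b, hb⟩]
    have := φ.map_adj_iff (v := ⟨a, ha⟩) (w := ⟨b, hb⟩)
    exact this.symm

lemma mem_cQ {r : ℕ} {Q : Finset (Fin n)} : Q ∈ cQ G r ↔
    (∀ a ∈ Q, ∀ b ∈ Q, a ≠ b → G.Adj a b) ∧ Q.card = r := by
  simp only [cQ, Finset.mem_filter, Finset.mem_univ, true_and, isNClique_iff, IsClique,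
    Set.Pairwise, Finset.mem_coe]

lemma mem_cN {x z : Fin n} : z ∈ cN G x ↔ z = x ∨ G.Adj x z := by simp [cN]

lemma LI.mem_cQ {y y' : Fin n} {σ : Equiv.Perm (Fin n)} (h : LI G H y y' σ) {r : ℕ}
    {Q : Finset (Fin n)} (hy : y ∉ Q) (hQ : Q ∈ cQ G r) : Q.map σ.toEmbedding ∈ cQ H r := by
  rw [_root_.mem_cQ] at hQ ⊢
  refine ⟨?_, by simpa using hQ.2⟩
  simp only [Finset.mem_map, Equiv.coe_toEmbedding, forall_exists_index, and_imp]
  rintro _ a ha rfl _ b hb rfl hab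
  refine (h.2 a b ?_ ?_).1 (hQ.1 a ha b hb ?_)
  · rintro rfl; exact hy ha
  · rintro rfl; exact hy hb
  · rintro rfl; exact hab rfl

lemma LI.sum {y y' : Fin n} {σ : Equiv.Perm (Fin n)} (h : LI G H y y' σ) (r : ℕ)
    {M : Type*} [AddCommMonoid M]
    (F F' : Finset (Fin n) → M) (hF : ∀ Q, y ∉ Q → F Q = F' (Q.map σ.toEmbedding)) :
    ∑ Q ∈ (cQ G r).filter (fun Q => y ∉ Q), F Q =
      ∑ Q ∈ (cQ H r).filter (fun Q => y' ∉ Q), F' Q := by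
  refine Finset.sum_bij' (fun Q _ => Q.map σ.toEmbedding)
    (fun Q _ => Q.map σ.symm.toEmbedding) ?_ ?_ ?_ ?_ ?_
  · intro Q hQ
    rw [Finset.mem_filter] at hQ ⊢
    refine ⟨h.mem_cQ hQ.2 hQ.1, ?_⟩
    rw [← h.1]
    simpa using hQ.2
  · intro Q hQ
    rw [Finset.mem_filter] at hQ ⊢
    refine ⟨h.symm.mem_cQ hQ.2 hQ.1, ?_⟩
    have := hQ.2
    rw [← h.1] at this
    simpa [Finset.mem_map, Equiv.symm_apply_eq] using this
  · intro Q _; ext; simp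
  · intro Q _; ext; simp
  · intro Q hQ
    rw [Finset.mem_filter] at hQ
    exact hF Q hQ.2

lemma LI.dd {y y' : Fin n} {σ : Equiv.Perm (Fin n)} (h : LI G H y y' σ) (r : ℕ) (x : Fin n) :
    dd G r x y = dd H r (σ x) y' := by
  have := h.sum r (fun Q => if x ∈ Q then 1 else 0) (fun Q => if σ x ∈ Q then 1 else 0)
    (by intro Q _; simp)
  rw [← Finset.card_filter, ← Finset.card_filter, Finset.filter_filter, Finset.filter_filter] at this
  simpa [_root_.dd, and_comm] using this

lemma LI.dgc {y y' : Fin n} {σ : Equiv.Perm (Fin n)} (h : LI G H y y' σ) {x : Fin n}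
    (hx : x ≠ y) : dgc G x y = dgc H (σ x) y' := by
  classical
  unfold _root_.dgc
  refine Finset.card_equiv σ ?_
  intro z
  simp only [Finset.mem_filter, Finset.mem_univ, true_and, ← h.1, ne_eq, σ.injective.eq_iff]
  constructor
  · rintro ⟨h1, h2⟩; exact ⟨h1, (h.2 _ _ hx h1).1 h2⟩
  · rintro ⟨h1, h2⟩; exact ⟨h1, (h.2 _ _ hx h1).2 h2⟩

lemma cN_card (x : Fin n) : (cN G x).card = dg G x + 1 := by
  classical
  have : cN G x = insert x (Finset.univ.filter (fun z => G.Adj x z)) := by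
    ext z; simp [cN]
  rw [this, Finset.card_insert_of_notMem (by simp), dg]
  

lemma dgc_add (x y : Fin n) [Decidable (G.Adj x y)] :
    dgc G x y + (if G.Adj x y then 1 else 0) = dg G x := by
  classical
  unfold dgc dg
  split_ifs with h
  · have hy : y ∈ Finset.univ.filter (fun z => G.Adj x z) := by simpa using h
    have e : Finset.univ.filter (fun z => z ≠ y ∧ G.Adj x z) =
        (Finset.univ.filter (fun z => G.Adj x z)).erase y := by
      ext z; simp
    rw [e, Finset.card_erase_add_one hy]
  · rw [add_zero]
    congr 1
    ext z; simp only [Finset.mem_filter, Finset.mem_univ, true_and]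
    constructor
    · exact fun h => h.2
    · intro h'; exact ⟨by rintro rfl; exact h h', h'⟩

lemma dr_le_cN {r : ℕ} {x : Fin n} {Q : Finset (Fin n)} (hQ : Q ∈ cQ G r) (hx : x ∈ Q) :
    Q ⊆ cN G x := by
  intro z hz
  rw [mem_cN]
  by_cases h : z = x
  · exact Or.inl h
  · exact Or.inr ((mem_cQ.1 hQ).1 x hx z hz (Ne.symm h))

lemma dd_eq_of_not_mem {r : ℕ} {x y : Fin n} (h : y ∉ cN G x) : dd G r x y = dr G r x := by
  unfold dd dr
  congr 1
  refine Finset.filter_congr ?_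
  intro Q hQ
  constructor
  · exact fun h => h.1
  · exact fun hx => ⟨hx, fun hy => h (dr_le_cN hQ hx hy)⟩

lemma dd_le {r : ℕ} {x y : Fin n} : dd G r x y ≤ dr G r x := by
  unfold dd dr
  exact Finset.card_le_card (Finset.monotone_filter_right _ (fun Q _ h => h.1))

lemma dd_self {r : ℕ} {x : Fin n} : dd G r x x = 0 := by
  simp [dd]

lemma dd_lt {r : ℕ} {x y : Fin n} {Q : Finset (Fin n)} (hQ : Q ∈ cQ G r) (hx : x ∈ Q)
    (hy : y ∈ Q) : dd G r x y < dr G r x := by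
  unfold dd dr
  refine Finset.card_lt_card ⟨Finset.monotone_filter_right _ (fun Q _ h => h.1), ?_⟩
  intro h
  have := h (Finset.mem_filter.2 ⟨hQ, hx⟩)
  simp [hy] at this

lemma sum_dr_inter (r : ℕ) (S : Finset (Fin n)) :
    ∑ x ∈ S, dr G r x = ∑ Q ∈ cQ G r, (Q ∩ S).card := by
  unfold dr
  simp_rw [Finset.card_filter]
  rw [Finset.sum_comm]
  refine Finset.sum_congr rfl fun Q _ => ?_
  rw [← Finset.card_filter]
  congr 1
  ext; simp [and_comm]

lemma sum_dr (r : ℕ) : ∑ x, dr G r x = r * (cQ G r).card := by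
  rw [sum_dr_inter, Finset.sum_congr rfl (g := fun _ => r)]
  · simp [mul_comm]
  · intro Q hQ; simpa using (mem_cQ.1 hQ).2

lemma LI.kap {y y' : Fin n} {σ : Equiv.Perm (Fin n)} (h : LI G H y y' σ) (r : ℕ) :
    (cQ G r).card + dr H r y' = (cQ H r).card + dr G r y := by
  have := h.sum r (fun Q => 1) (fun Q => 1) (by simp)
  rw [← Finset.card_eq_sum_ones, ← Finset.card_eq_sum_ones] at this
  have h1 := Finset.card_filter_add_card_filter_not (s := cQ G r) (fun Q => y ∈ Q)
  have h2 := Finset.card_filter_add_card_filter_not (s := cQ H r) (fun Q => y' ∈ Q)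
  unfold dr
  omega

/-- Kelly-type relation for clique counts. -/
lemma Sh.kelly {p : Equiv.Perm (Fin n)} {u : Fin n} (h : Sh G H p u) (r : ℕ) :
    ((n : ℤ) - 1 - r) * (((cQ G r).card : ℤ) - (cQ H r).card) = dr H r (p u) - dr G r u := by
  have h1 : ∑ x ∈ Finset.univ.erase u, ((dr G r x : ℤ) - dr H r (p x)) =
      ∑ x ∈ Finset.univ.erase u, (((cQ G r).card : ℤ) - (cQ H r).card) := by
    refine Finset.sum_congr rfl fun x hx => ?_
    obtain ⟨σ, hσ⟩ := h x (by simpa using hx)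
    have := hσ.kap r
    omega
  have hn : 1 ≤ n := by have := u.2; omega
  rw [Finset.sum_const, Finset.card_erase_of_mem (Finset.mem_univ _), Finset.card_univ,
    Fintype.card_fin, nsmul_eq_mul, Nat.cast_sub hn] at h1
  have h2 := Finset.add_sum_erase Finset.univ (fun x => (dr G r x : ℤ) - dr H r (p x))
    (Finset.mem_univ u)
  have h3 : ∑ x, ((dr G r x : ℤ) - dr H r (p x)) =
      r * (cQ G r).card - r * (cQ H r).card := by
    rw [Finset.sum_sub_distrib, Equiv.sum_comp p (fun x => (dr H r x : ℤ))]
    have a := sum_dr (G := G) r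
    have b := sum_dr (G := H) r
    zify at a b
    rw [a, b]
  rw [h3, h1] at h2
  push_cast at h2
  linarith

lemma dr_two (x : Fin n) : dr G 2 x = dg G x := by
  classical
  symm
  unfold dr dg
  refine Finset.card_bij (fun z _ => {x, z}) ?_ ?_ ?_
  · intro z hz
    have hz : G.Adj x z := by simpa using hz
    rw [Finset.mem_filter, mem_cQ]
    refine ⟨⟨?_, Finset.card_pair hz.ne⟩, by simp⟩
    simp only [Finset.mem_insert, Finset.mem_singleton]
    rintro a (rfl | rfl) b (rfl | rfl) hab
    · exact absurd rfl hab
    · exact hz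
    · exact hz.symm
    · exact absurd rfl hab
  · intro a ha b hb hab
    have ha : G.Adj x a := by simpa using ha
    have : a ∈ ({x, b} : Finset (Fin n)) := by rw [← hab]; simp
    simp only [Finset.mem_insert, Finset.mem_singleton] at this
    rcases this with rfl | h
    · exact absurd rfl ha.ne
    · exact h
  · intro Q hQ
    rw [Finset.mem_filter, mem_cQ] at hQ
    obtain ⟨⟨h1, h2⟩, hx⟩ := hQ
    obtain ⟨a, b, hab, rfl⟩ := Finset.card_eq_two.1 h2
    simp only [Finset.mem_insert, Finset.mem_singleton] at hx
    rcases hx with rfl | rfl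
    · exact ⟨b, by simpa using h1 x (by simp) b (by simp) hab, rfl⟩
    · exact ⟨a, by simpa using h1 x (by simp) a (by simp) hab.symm, Finset.pair_comm _ _⟩

/-- Edge counts agree. -/
lemma Sh.edges (hn : 7 ≤ n) {p : Equiv.Perm (Fin n)} {u : Fin n} (h : Sh G H p u)
    (hD : ∀ x, 2 * dg G x + 2 ≤ n) :
    (cQ G 2).card = (cQ H 2).card ∧ ∀ x, dg G x = dg H (p x) := by
  classical
  have hk := h.kelly 2
  rw [dr_two, dr_two] at hk
  have hu := hD u
  have heq : (cQ G 2).card = (cQ H 2).card := by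
    rcases lt_trichotomy (cQ G 2).card (cQ H 2).card with hlt | heq | hgt
    · exfalso
      have : ((n : ℤ) - 3) * ((cQ H 2).card - (cQ G 2).card) ≥ ((n : ℤ) - 3) * 1 := by
        apply mul_le_mul_of_nonneg_left <;> omega
      push_cast at hk
      nlinarith
    · exact heq
    · exfalso
      have : ((n : ℤ) - 3) * ((cQ G 2).card - (cQ H 2).card) ≥ ((n : ℤ) - 3) * 1 := by
        apply mul_le_mul_of_nonneg_left <;> omega
      have hw : n ≤ dg H (p u) + 3 := by
        push_cast at hk
        zify
        nlinarith
      have : ∃ y, y ≠ u := by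
        have : Nontrivial (Fin n) := Fin.nontrivial_iff_two_le.2 (by omega)
        exact exists_ne u
      obtain ⟨y, hy⟩ := this
      obtain ⟨σ, hσ⟩ := h y hy
      have hne : p u ≠ p y := fun h => hy (p.injective h).symm
      have e1 := hσ.symm.dgc hne
      have e2 := dgc_add (G := H) (p u) (p y)
      have e3 := dgc_add (G := G) (σ.symm (p u)) y
      have := hD (σ.symm (p u))
      split_ifs at e2 e3 <;> omega
  refine ⟨heq, fun x => ?_⟩
  by_cases hx : x = u
  · subst hx
    rw [heq] at hk
    simp only [sub_self, mul_zero] at hk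
    omega
  · obtain ⟨σ, hσ⟩ := h x hx
    have := hσ.kap 2
    rw [dr_two, dr_two] at this
    omega

end

section
variable {n : ℕ} {G H : SimpleGraph (Fin n)}

lemma exists_far (hn : 7 ≤ n) (hD : ∀ x, 2 * dg G x + 2 ≤ n) (x u : Fin n) :
    ∃ y, y ≠ u ∧ y ∉ cN G x := by
  classical
  by_contra! hc
  have : (Finset.univ : Finset (Fin n)) ⊆ insert u (cN G x) := by
    intro y _
    rw [Finset.mem_insert]
    by_cases h : y = u
    · exact Or.inl h
    · exact Or.inr (hc y h)
  have h1 := Finset.card_le_card this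
  have h2 := Finset.card_insert_le u (cN G x)
  rw [cN_card] at h2
  rw [Finset.card_univ, Fintype.card_fin] at h1
  have := hD x
  omega

lemma Sh.exists_le (hn : 7 ≤ n) {p : Equiv.Perm (Fin n)} {u : Fin n} (h : Sh G H p u)
    (hD : ∀ x, 2 * dg G x + 2 ≤ n) (r : ℕ) (x : Fin n) : ∃ z, dr G r x ≤ dr H r z := by
  obtain ⟨y, hy, hy'⟩ := exists_far hn hD x u
  obtain ⟨σ, hσ⟩ := h y hy
  refine ⟨σ x, ?_⟩
  rw [← dd_eq_of_not_mem hy', hσ.dd]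
  exact dd_le

lemma sum_far (r : ℕ) (v : Fin n) (k : ℕ)
    (hk : dg G v + 1 + r + k = n) :
    ∑ y ∈ (cN G v)ᶜ, ∑ Q ∈ (cQ G r).filter (fun Q => y ∉ Q),
      (((Q ∩ cN G v).card : ℚ) / (k + (Q ∩ cN G v).card)) = ∑ x ∈ cN G v, (dr G r x : ℚ) := by
  have h0 : ∑ x ∈ cN G v, (dr G r x : ℚ) = ∑ Q ∈ cQ G r, ((Q ∩ cN G v).card : ℚ) := by
    exact_mod_cast sum_dr_inter r (cN G v)
  rw [h0]
  simp_rw [Finset.sum_filter]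
  rw [Finset.sum_comm]
  refine Finset.sum_congr rfl fun Q hQ => ?_
  rw [← Finset.sum_filter, Finset.sum_const, nsmul_eq_mul]
  have e : ((cN G v)ᶜ.filter (fun y => y ∉ Q)) = (Q ∪ cN G v)ᶜ := by
    ext y; simp [and_comm]
  have h1 := Finset.card_union_add_card_inter Q (cN G v)
  have h2 := Finset.card_add_card_compl (Q ∪ cN G v)
  rw [cN_card, (mem_cQ.1 hQ).2] at h1
  rw [Fintype.card_fin] at h2
  have h3 : (Q ∪ cN G v)ᶜ.card = k + (Q ∩ cN G v).card := by omega
  rw [e, h3]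
  push_cast
  by_cases hz : (Q ∩ cN G v).card = 0
  · simp [hz]
  · have : (k : ℚ) + (Q ∩ cN G v).card ≠ 0 := by
      have : 0 < (Q ∩ cN G v).card := Nat.pos_of_ne_zero hz
      positivity
    field_simp

lemma Sh.main (hn : 7 ≤ n) {p : Equiv.Perm (Fin n)} {u : Fin n} (h : Sh G H p u)
    (hD : ∀ x, 2 * dg G x + 2 ≤ n) (hdeg : ∀ x, dg G x = dg H (p x)) {r : ℕ} (hr : 3 ≤ r)
    (hlt : (cQ H r).card < (cQ G r).card) : False := by
  classical
  have hDH : ∀ x, 2 * dg H x + 2 ≤ n := by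
    intro x
    have := hD (p.symm x)
    rw [hdeg] at this
    simpa using this
  obtain ⟨c, hc⟩ := Nat.exists_eq_add_of_lt hlt
  have hrn : ∃ x, r ≤ dg G x + 1 := by
    have : (cQ G r).Nonempty := Finset.card_pos.1 (by omega)
    obtain ⟨Q, hQ⟩ := this
    have hQr := (mem_cQ.1 hQ).2
    have : Q.Nonempty := Finset.card_pos.1 (by omega)
    obtain ⟨x, hx⟩ := this
    refine ⟨x, ?_⟩
    rw [← cN_card, ← hQr]
    exact Finset.card_le_card (dr_le_cN hQ hx)
  have hr2 : 2 * r ≤ n := by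
    obtain ⟨x, hx⟩ := hrn
    have := hD x
    omega
  have hf : ∀ y, y ≠ u → dr G r y = dr H r (p y) + (c + 1) := by
    intro y hy
    obtain ⟨σ, hσ⟩ := h y hy
    have := hσ.kap r
    omega
  obtain ⟨m, hm⟩ : ∃ m, n = 1 + r + m := Nat.exists_eq_add_of_le (by omega)
  have hw : dr H r (p u) = dr G r u + m * (c + 1) := by
    have hk := h.kelly r
    have e1 : (n : ℤ) - 1 - r = m := by omega
    have e2 : ((cQ G r).card : ℤ) - (cQ H r).card = c + 1 := by omega
    rw [e1, e2] at hk
    zify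
    linarith
  have hm1 : 2 ≤ m := by omega
  have hmc : 2 ≤ m * (c + 1) := by nlinarith
  have hGH := h.exists_le hn hD r
  have hHG := h.symm.exists_le hn hDH r
  set w := p u with hwdef
  set M := dr H r w with hM
  -- `w` is the unique maximum of `dr H`
  have hmax : ∀ z, z ≠ w → dr H r z + (c + 1) ≤ M := by
    obtain ⟨z0, -, hz0⟩ := Finset.exists_max_image Finset.univ (dr H r) ⟨w, Finset.mem_univ _⟩
    have hz0w : z0 = w := by
      by_contra hne
      have hne' : p.symm z0 ≠ u := by
        intro h; apply hne; rw [hwdef, ← h]; simp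
      have e := hf _ hne'
      rw [Equiv.apply_symm_apply] at e
      obtain ⟨z, hz⟩ := hGH (p.symm z0)
      have := hz0 z (Finset.mem_univ _)
      omega
    subst hz0w
    intro z hz
    have hne' : p.symm z ≠ u := by
      intro h; apply hz; rw [hwdef, ← h]; simp
    have e := hf _ hne'
    rw [Equiv.apply_symm_apply] at e
    obtain ⟨z', hz'⟩ := hGH (p.symm z)
    have := hz0 z' (Finset.mem_univ _)
    omega
  have hGM : ∀ x, dr G r x ≤ M := by
    intro x
    obtain ⟨z, hz⟩ := hGH x
    by_cases hzw : z = w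
    · rw [hzw] at hz; exact hz
    · have := hmax z hzw
      omega
  -- a maximum vertex `v` of `G`
  obtain ⟨v, hv⟩ : ∃ v, dr G r v = M := by
    obtain ⟨v, hv⟩ := hHG w
    exact ⟨v, le_antisymm (hGM v) hv⟩
  have hvu : v ≠ u := by
    rintro rfl
    omega
  have hMpos : 0 < M := by omega
  -- survivors
  have hsurv : ∀ y, y ≠ u → ∀ σ, LI G H y (p y) σ → ∀ x, dd G r x y = M →
      σ x = w ∧ dd H r w (p y) = M := by
    intro y hy σ hσ x hx
    rw [hσ.dd] at hx
    have h1 := dd_le (G := H) (r := r) (x := σ x) (y := p y)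
    have : σ x = w := by
      by_contra hne
      have := hmax _ hne
      omega
    exact ⟨this, by rw [← this]; exact hx⟩
  -- number of survivors in `H`
  have hHs : ((Finset.univ.filter (fun z => dd H r w z = M)).card) + 3 ≤ n := by
    have : ((cQ H r).filter (fun Q => w ∈ Q)).Nonempty := Finset.card_pos.1 hMpos
    obtain ⟨Q, hQ⟩ := this
    rw [Finset.mem_filter] at hQ
    have hsub : Finset.univ.filter (fun z => dd H r w z = M) ⊆ Qᶜ := by
      intro z hz
      rw [Finset.mem_compl]
      intro hzQ
      have := dd_lt hQ.1 hQ.2 hzQ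
      rw [Finset.mem_filter] at hz
      omega
    have h1 := Finset.card_le_card hsub
    have h2 := Finset.card_add_card_compl Q
    rw [(mem_cQ.1 hQ.1).2, Fintype.card_fin] at h2
    omega
  have hfar : ∀ x, n ≤ 2 * ((Finset.univ.filter (fun y => y ≠ u ∧ y ∉ cN G x)).card) + 2 := by
    intro x
    have e : Finset.univ.filter (fun y => y ≠ u ∧ y ∉ cN G x) = (insert u (cN G x))ᶜ := by
      ext y; simp
    have h1 := Finset.card_insert_le u (cN G x)
    have h2 := Finset.card_add_card_compl (insert u (cN G x))
    rw [← e, Fintype.card_fin] at h2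
    rw [cN_card] at h1
    have := hD x
    omega
  have huniq : ∀ x, dr G r x = M → x = v := by
    intro x hx
    by_contra hne
    set A := Finset.univ.filter (fun y => y ≠ u ∧ y ∉ cN G x)
    set B := Finset.univ.filter (fun y => y ≠ u ∧ y ∉ cN G v)
    have hdis : Disjoint A B := by
      rw [Finset.disjoint_left]
      intro y hyA hyB
      rw [Finset.mem_filter] at hyA hyB
      obtain ⟨σ, hσ⟩ := h y hyA.2.1
      have a := hsurv y hyA.2.1 σ hσ x (by rw [dd_eq_of_not_mem hyA.2.2, hx])
      have b := hsurv y hyA.2.1 σ hσ v (by rw [dd_eq_of_not_mem hyB.2.2, hv])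
      exact hne (σ.injective (a.1.trans b.1.symm))
    have hsub : (A ∪ B).map p.toEmbedding ⊆ Finset.univ.filter (fun z => dd H r w z = M) := by
      intro z hz
      rw [Finset.mem_map] at hz
      obtain ⟨y, hy, rfl⟩ := hz
      rw [Finset.mem_filter]
      refine ⟨Finset.mem_univ _, ?_⟩
      rcases Finset.mem_union.1 hy with hy | hy
      · rw [Finset.mem_filter] at hy
        obtain ⟨σ, hσ⟩ := h y hy.2.1
        exact (hsurv y hy.2.1 σ hσ x (by rw [dd_eq_of_not_mem hy.2.2, hx])).2
      · rw [Finset.mem_filter] at hy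
        obtain ⟨σ, hσ⟩ := h y hy.2.1
        exact (hsurv y hy.2.1 σ hσ v (by rw [dd_eq_of_not_mem hy.2.2, hv])).2
    have h1 := Finset.card_le_card hsub
    rw [Finset.card_map, Finset.card_union_of_disjoint hdis] at h1
    have h2 : n ≤ 2 * A.card + 2 := hfar x
    have h3 : n ≤ 2 * B.card + 2 := hfar v
    omega
  have hsurv' : ∀ y, y ≠ u → ∀ σ, LI G H y (p y) σ → dd H r w (p y) = M →
      σ v = w ∧ dd G r v y = M := by
    intro y hy σ hσ hx
    rw [hσ.symm.dd] at hx
    have h1 := dd_le (G := G) (r := r) (x := σ.symm w) (y := y)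
    have h2 := hGM (σ.symm w)
    have h3 : σ.symm w = v := huniq _ (by omega)
    refine ⟨by rw [← h3]; simp, by rw [← h3]; exact hx⟩
  -- degrees of `v` and `w` agree
  have hnev : ∀ y, dd G r v y = M → v ≠ y := by
    rintro y hy rfl
    rw [dd_self] at hy; omega
  have hnew : ∀ y, dd H r w y = M → w ≠ y := by
    intro y hy hwy
    rw [← hwy, dd_self] at hy; omega
  have hdvw : dg G v = dg H w := by
    apply le_antisymm
    · obtain ⟨y, hy, hy'⟩ := exists_far hn hD v u
      obtain ⟨σ, hσ⟩ := h y hy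
      have e : dd G r v y = M := by rw [dd_eq_of_not_mem hy', hv]
      have a := hsurv y hy σ hσ v e
      have b := hσ.dgc (hnev y e)
      rw [a.1] at b
      have e1 := dgc_add (G := G) v y
      have e2 := dgc_add (G := H) w (p y)
      rw [mem_cN, not_or] at hy'
      rw [if_neg hy'.2] at e1
      omega
    · obtain ⟨z, hz, hz'⟩ := exists_far hn hDH w w
      obtain ⟨y, rfl⟩ := p.surjective z
      have hy : y ≠ u := by rintro rfl; exact hz rfl
      obtain ⟨σ, hσ⟩ := h y hy
      have e : dd H r w (p y) = M := by rw [dd_eq_of_not_mem hz']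
      have a := hsurv' y hy σ hσ e
      have b := hσ.dgc (hnev y a.2)
      rw [a.1] at b
      have e1 := dgc_add (G := G) v y
      have e2 := dgc_add (G := H) w (p y)
      rw [mem_cN, not_or] at hz'
      rw [if_neg hz'.2] at e2
      omega
  have hNiff : ∀ y, y ≠ u → (y ∈ cN G v ↔ p y ∈ cN H w) := by
    intro y hy
    obtain ⟨σ, hσ⟩ := h y hy
    have hpw : p y ≠ w := fun h => hy (p.injective h)
    by_cases e : dd G r v y = M
    · have a := hsurv y hy σ hσ v e
      have b := hσ.dgc (hnev y e)
      rw [a.1] at b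
      have e1 := dgc_add (G := G) v y
      have e2 := dgc_add (G := H) w (p y)
      rw [mem_cN, mem_cN]
      have := hnev y e
      have h1 : ¬ y = v := fun h => this h.symm
      simp only [h1, hpw, false_or]
      split_ifs at e1 e2 with i1 i2 i2 <;> first | omega | tauto
    · have e' : dd H r w (p y) ≠ M := fun h => e (hsurv' y hy σ hσ h).2
      have i1 : y ∈ cN G v := by
        by_contra hc; exact e (by rw [dd_eq_of_not_mem hc, hv])
      have i2 : p y ∈ cN H w := by
        by_contra hc; exact e' (by rw [dd_eq_of_not_mem hc])
      tauto
  have hwN : w ∈ cN H w := mem_cN.2 (Or.inl rfl)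
  have huN : u ∈ cN G v := by
    by_contra hc
    have hsub : insert w ((cN G v).map p.toEmbedding) ⊆ cN H w := by
      intro z hz
      rw [Finset.mem_insert] at hz
      rcases hz with rfl | hz
      · exact hwN
      · rw [Finset.mem_map] at hz
        obtain ⟨y, hy, rfl⟩ := hz
        exact (hNiff y (by rintro rfl; exact hc hy)).1 hy
    have h1 := Finset.card_le_card hsub
    rw [Finset.card_insert_of_notMem, Finset.card_map, cN_card, cN_card, hdvw] at h1
    · omega
    · simp only [Finset.mem_map_equiv]
      rw [hwdef]; simpa using hc
  have hNmap : cN H w = (cN G v).map p.toEmbedding := by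
    ext z
    rw [Finset.mem_map_equiv]
    by_cases hz : p.symm z = u
    · have : z = w := by rw [hwdef, ← hz]; simp
      rw [hz, this]; tauto
    · rw [hNiff _ hz]; simp
  -- the sum over closed neighbourhoods
  set d := dg G v with hd
  have hsum : ∑ z ∈ cN H w, dr H r z + d * (c + 1) = ∑ x ∈ cN G v, dr G r x + m * (c + 1) := by
    rw [hNmap, Finset.sum_map]
    rw [← Finset.add_sum_erase _ _ huN, ← Finset.add_sum_erase _ (dr G r) huN]
    have e : ∑ x ∈ (cN G v).erase u, dr G r x =
        ∑ x ∈ (cN G v).erase u, dr H r (p x) + d * (c + 1) := by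
      rw [Finset.sum_congr rfl (fun x hx => hf x (Finset.ne_of_mem_erase hx)),
        Finset.sum_add_distrib, Finset.sum_const, Finset.card_erase_of_mem huN, cN_card]
      simp [hd]
    rw [e]
    simp only [Equiv.coe_toEmbedding]
    rw [← hwdef, ← hM, hw]
    ring
  have hdD := hD v
  obtain ⟨k, hk⟩ : ∃ k, n = d + 1 + r + k := Nat.exists_eq_add_of_le (by omega)
  have hSS : ∑ z ∈ cN H w, (dr H r z : ℚ) = ∑ x ∈ cN G v, (dr G r x : ℚ) := by
    rw [← sum_far (G := H) r w k (by omega), ← sum_far (G := G) r v k (by omega)]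
    symm
    refine Finset.sum_equiv p ?_ ?_
    · intro y
      rw [Finset.mem_compl, Finset.mem_compl, hNmap, Finset.mem_map_equiv]
      simp
    · intro y hy
      rw [Finset.mem_compl] at hy
      have hyu : y ≠ u := by rintro rfl; exact hy huN
      obtain ⟨σ, hσ⟩ := h y hyu
      have e : dd G r v y = M := by rw [dd_eq_of_not_mem hy, hv]
      have a := (hsurv y hyu σ hσ v e).1
      refine hσ.sum r _ _ ?_
      intro Q hQ
      have : Q.map σ.toEmbedding ∩ cN H w = (Q ∩ cN G v).map σ.toEmbedding := by
        ext z
        simp only [Finset.mem_inter, Finset.mem_map_equiv]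
        refine and_congr_right fun hz => ?_
        rw [mem_cN, mem_cN, ← a, Equiv.symm_apply_eq]
        refine or_congr Iff.rfl ?_
        have := hσ.2 v (σ.symm z) (hnev y e) (by rintro h; rw [h] at hz; exact hQ hz)
        rw [this]; simp
      rw [this, Finset.card_map]
  have hSS' : ∑ z ∈ cN H w, dr H r z = ∑ x ∈ cN G v, dr G r x := by exact_mod_cast hSS
  have hdm : d = m := by
    rw [hSS'] at hsum
    exact Nat.eq_of_mul_eq_mul_right (Nat.succ_pos c) (by simpa using hsum)
  have hrd : r = d + 1 := by omega
  have hle : dr H r w ≤ 1 := by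
    unfold dr
    rw [Finset.card_le_one]
    have key : ∀ Q ∈ (cQ H r).filter (fun Q => w ∈ Q), Q = cN H w := by
      intro Q hQ
      rw [Finset.mem_filter] at hQ
      apply Finset.eq_of_subset_of_card_le (dr_le_cN hQ.1 hQ.2)
      rw [cN_card, (mem_cQ.1 hQ.1).2]
      omega
    intro a ha b hb
    rw [key a ha, key b hb]
  omega

lemma Sh.all (hn : 7 ≤ n) {p : Equiv.Perm (Fin n)} {u : Fin n} (h : Sh G H p u)
    (hD : ∀ x, 2 * dg G x + 2 ≤ n) (r : ℕ) (hr : 1 ≤ r) : (cQ G r).card = (cQ H r).card := by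
  obtain ⟨h2, hdeg⟩ := h.edges hn hD
  have hdeg' : ∀ x, dg H x = dg G (p.symm x) := by intro x; rw [hdeg]; simp
  have hDH : ∀ x, 2 * dg H x + 2 ≤ n := by intro x; rw [hdeg']; exact hD _
  rcases Nat.lt_or_ge r 3 with hr3 | hr3
  · interval_cases r
    · have key : ∀ K : SimpleGraph (Fin n), (cQ K 1).card = n := by
        intro K
        have h1 := sum_dr (G := K) 1
        have : cQ K 1 = Finset.univ.powersetCard 1 := by
          ext Q
          rw [mem_cQ, Finset.mem_powersetCard]
          constructor
          · exact fun h => ⟨Finset.subset_univ _, h.2⟩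
          · rintro ⟨-, h⟩
            refine ⟨?_, h⟩
            intro a ha b hb hab
            exact absurd (Finset.card_le_one.1 h.le a ha b hb) hab
        rw [this, Finset.card_powersetCard]; simp
      rw [key, key]
    · exact h2
  · rcases lt_trichotomy (cQ G r).card (cQ H r).card with hlt | heq | hgt
    · exact (h.symm.main hn hDH hdeg' hr3 hlt).elim
    · exact heq
    · exact (h.main hn hD hdeg hr3 hgt).elim

end

lemma kappa_eq {n : ℕ} (G : SimpleGraph (Fin n)) (r : ℕ) : kappa G r = (cQ G r).card := by
  classical
  unfold kappa
  rw [← Set.ncard_coe_finset]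
  congr 1
  ext Q
  simp [cQ, mem_cliqueSet_iff]

lemma deg_eq {n : ℕ} (G : SimpleGraph (Fin n)) (x : Fin n) : deg G x = dg G x := by
  classical
  unfold deg dg
  rw [← Set.ncard_coe_finset]
  congr 1
  ext z
  simp

theorem clique_count_of_small_maxDeg {n : ℕ} (hn : 7 ≤ n)
    (G H : SimpleGraph (Fin n)) (hshare : ShareCards G H)
    (hDelta : 2 * maxDeg G + 2 ≤ n) :
    ∀ r : ℕ, 1 ≤ r → kappa G r = kappa H r := by
  intro r hr
  obtain ⟨p, u, h⟩ := hshare.sh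
  rw [kappa_eq, kappa_eq]
  refine h.all hn (fun x => ?_) r hr
  have : deg G x ≤ maxDeg G :=
    Finset.le_sup (f := fun v => deg G v) (Finset.mem_univ x)
  rw [deg_eq] at this
  omega
end

section
/- There exists n₀ such that for all n ≥ n₀ the following holds: for every integer k with 0 ≤ k ≤ 0.05·√n, if G and H are simple graphs on n vertices that share n−k cards, then G and H have the same number of edges. -/
open SimpleGraph

/-- `G` and `H` share `m` cards: there are `m`-element subsets `S`, `T` of the vertex
sets and a bijection `π : S → T` such that for every `v ∈ S` the card `G - v` is
isomorphic to the card `H - π(v)`. -/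
def ShareManyCards {n : ℕ} (G H : SimpleGraph (Fin n)) (m : ℕ) : Prop :=
  ∃ (S T : Finset (Fin n)) (π : {x : Fin n // x ∈ S} ≃ {y : Fin n // y ∈ T}),
    S.card = m ∧ T.card = m ∧
    ∀ v : {x : Fin n // x ∈ S}, Nonempty (gcard G v.1 ≃g gcard H (π v).1)

/-! ### The numerical part -/

/-- A sequence of integers satisfying the approximate recursion vanishes identically. -/
theorem delta_zero (n k : ℕ) (δ : ℕ → ℤ) (hn : 10000 ≤ n) (hk : 400 * k ^ 2 ≤ n)
    (hlow : ∀ d, -(k : ℤ) ≤ δ d)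
    (h1 : ∀ d : ℕ, -((k : ℤ) * (1 + k + δ d)) ≤ ((n : ℤ) - 1 - k - d) * δ d + d * δ (d + 1))
    (h2 : ∀ d : ℕ, ((n : ℤ) - 1 - k - d) * δ d + d * δ (d + 1) ≤ (k : ℤ) * (1 + k + δ (d + 1))) :
    ∀ d, d ≤ n → δ d = 0 := by
  have hkZ : 400 * (k : ℤ) ^ 2 ≤ n := by exact_mod_cast hk
  have hnZ : (10000 : ℤ) ≤ n := by exact_mod_cast hn
  have hk0 : (0 : ℤ) ≤ k := by positivity
  have hksmall : 40 * (k : ℤ) ≤ n / 5 := by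
    have : 200 * (k : ℤ) ≤ n := by
      by_contra hc
      push Not at hc
      nlinarith
    omega
  have hkk : (k : ℤ) ^ 2 = k * k := by ring
  -- upper bound in the middle range
  have hup : ∀ d : ℕ, n ≤ 4 * d + 4 → 5 * d ≤ 2 * n → δ d ≤ 2 * k := by
    intro d hd1 hd2
    have hd1Z : (n : ℤ) ≤ 4 * d + 4 := by exact_mod_cast hd1
    have hd2Z : 5 * (d : ℤ) ≤ 2 * n := by exact_mod_cast hd2
    have e2 := h2 d
    have e3 := hlow (d + 1)
    have e4 : 0 ≤ ((d : ℤ) - k) * (δ (d + 1) + k) := mul_nonneg (by omega) (by omega)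
    have e5 : ((n : ℤ) - 1 - k - d) * δ d ≤ k * (1 + d) := by nlinarith
    by_contra hc
    push Not at hc
    have e6 : ((n : ℤ) - 1 - k - d) * (2 * k + 1) ≤ ((n : ℤ) - 1 - k - d) * δ d :=
      mul_le_mul_of_nonneg_left (by omega) (by omega)
    have e7 : (k : ℤ) * (1 + d) ≤ k * ((n : ℤ) - 1 - k - d) :=
      mul_le_mul_of_nonneg_left (by omega) hk0
    have e8 : 0 < ((n : ℤ) - 1 - k - d) * (k + 1) := mul_pos (by omega) (by omega)
    nlinarith
  have herr : (k : ℤ) * (1 + 3 * k) ≤ n / 50 := by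
    have : 50 * ((k : ℤ) * (1 + 3 * k)) ≤ n := by nlinarith
    omega
  have herr2 : (k : ℤ) * (1 + k) ≤ n / 50 := by nlinarith
  -- growth
  have hgrow : ∀ d : ℕ, n ≤ 4 * d + 4 → 3 * d ≤ n → δ d ≠ 0 → |δ d| + 1 ≤ |δ (d + 1)| := by
    intro d hd1 hd2 hx
    have hd1Z : (n : ℤ) ≤ 4 * d + 4 := by exact_mod_cast hd1
    have hd2Z : 3 * (d : ℤ) ≤ n := by exact_mod_cast hd2
    have ux := hup d hd1 (by omega)
    have uy := hup (d + 1) (by omega) (by omega)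
    have e1 := h1 d
    have e2 := h2 d
    have f1 : (k : ℤ) * (1 + k + δ d) ≤ k * (1 + 3 * k) :=
      mul_le_mul_of_nonneg_left (by omega) hk0
    have f2 : (k : ℤ) * (1 + k + δ (d + 1)) ≤ k * (1 + 3 * k) :=
      mul_le_mul_of_nonneg_left (by omega) hk0
    by_contra hc
    push Not at hc
    have hyx : |δ (d + 1)| ≤ |δ d| := by omega
    have hx1 : 1 ≤ |δ d| := Int.one_le_abs hx
    have g1 : (d : ℤ) * |δ (d + 1)| ≤ d * |δ d| := mul_le_mul_of_nonneg_left hyx (by omega)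
    have g2 : |((n : ℤ) - 1 - k - d) * δ d| = ((n : ℤ) - 1 - k - d) * |δ d| := by
      rw [abs_mul, abs_of_nonneg (by omega)]
    have g3 : |(d : ℤ) * δ (d + 1)| = d * |δ (d + 1)| := by
      rw [abs_mul, abs_of_nonneg (by omega)]
    have g4 : |((n : ℤ) - 1 - k - d) * δ d + d * δ (d + 1)| ≤ n / 50 :=
      abs_le.2 ⟨by omega, by omega⟩
    have g5 := abs_sub_abs_le_abs_sub (((n : ℤ) - 1 - k - d) * δ d) (-(d * δ (d + 1)))
    rw [abs_neg, sub_neg_eq_add, g2, g3] at g5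
    have g6 : ((n : ℤ) - 1 - k - 2 * d) * 1 ≤ ((n : ℤ) - 1 - k - 2 * d) * |δ d| :=
      mul_le_mul_of_nonneg_left hx1 (by omega)
    have g7 : ((n : ℤ) - 1 - k - 2 * d) * |δ d| ≤ n / 50 := by linarith
    omega
  obtain ⟨d0, hd0, hd0'⟩ : ∃ d0 : ℕ, 4 * d0 ≤ n ∧ n ≤ 4 * d0 + 4 := ⟨n / 4, by omega, by omega⟩
  have hz : δ d0 = 0 := by
    by_contra hne
    have key : ∀ j : ℕ, 3 * (d0 + j) ≤ n → (j : ℤ) + 1 ≤ |δ (d0 + j)| := by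
      intro j
      induction j with
      | zero => intro _; simpa using Int.one_le_abs hne
      | succ j ih =>
        intro hj
        have := ih (by omega)
        have h0 : δ (d0 + j) ≠ 0 := by
          intro h; rw [h] at this; simp at this; omega
        have := hgrow (d0 + j) (by omega) (by omega) h0
        rw [← add_assoc]; push_cast; omega
    have hj : 3 * (d0 + n / 20) ≤ n := by omega
    have q := key (n / 20) hj
    have q2 := hup (d0 + n / 20) (by omega) (by omega)
    have q3 := hlow (d0 + n / 20)
    have q4 : |δ (d0 + n / 20)| ≤ 2 * k := abs_le.2 ⟨by omega, q2⟩
    push_cast at q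
    omega
  have hupz : ∀ j, δ (d0 + j) = 0 := by
    intro j
    induction j with
    | zero => simpa using hz
    | succ j ih =>
      have e1 := h1 (d0 + j)
      have e2 := h2 (d0 + j)
      rw [ih] at e1 e2
      rw [← add_assoc]
      generalize δ (d0 + j + 1) = y at *
      have hd : (n : ℤ) ≤ 4 * ((d0 + j : ℕ) : ℤ) + 4 := by push_cast; omega
      generalize ((d0 + j : ℕ) : ℤ) = D at *
      rcases lt_trichotomy y 0 with h | h | h
      · have : D * y ≤ D * (-1) := mul_le_mul_of_nonneg_left (by omega) (by omega)
        nlinarith [Int.ediv_mul_le (n : ℤ) (show (50 : ℤ) ≠ 0 by norm_num)]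
      · exact h
      · have : (D - k) * 1 ≤ (D - k) * y := mul_le_mul_of_nonneg_left (by omega) (by omega)
        nlinarith [Int.ediv_mul_le (n : ℤ) (show (50 : ℤ) ≠ 0 by norm_num)]
  have hdownz : ∀ j, j ≤ d0 → δ (d0 - j) = 0 := by
    intro j
    induction j with
    | zero => intro _; simpa using hz
    | succ j ih =>
      intro hj
      have ih' := ih (by omega)
      have e1 := h1 (d0 - (j + 1))
      have e2 := h2 (d0 - (j + 1))
      have hs : d0 - (j + 1) + 1 = d0 - j := by omega
      rw [hs, ih'] at e1 e2
      have hd : 4 * ((d0 - (j + 1) : ℕ) : ℤ) ≤ n := by omega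
      generalize δ (d0 - (j + 1)) = y at *
      generalize ((d0 - (j + 1) : ℕ) : ℤ) = D at *
      rcases lt_trichotomy y 0 with h | h | h
      · have : ((n : ℤ) - 1 - D) * y ≤ ((n : ℤ) - 1 - D) * (-1) :=
          mul_le_mul_of_nonneg_left (by omega) (by omega)
        nlinarith [Int.ediv_mul_le (n : ℤ) (show (50 : ℤ) ≠ 0 by norm_num)]
      · exact h
      · have : ((n : ℤ) - 1 - k - D) * 1 ≤ ((n : ℤ) - 1 - k - D) * y :=
          mul_le_mul_of_nonneg_left (by omega) (by omega)
        nlinarith [Int.ediv_mul_le (n : ℤ) (show (50 : ℤ) ≠ 0 by norm_num)]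
  intro d _
  rcases le_total d d0 with h | h
  · have := hdownz (d0 - d) (by omega)
    rwa [show d0 - (d0 - d) = d by omega] at this
  · have := hupz (d - d0)
    rwa [show d0 + (d - d0) = d by omega] at this

/-! ### The graph part -/

section GraphPart

open Classical Finset

variable {n : ℕ}

/-- Number of vertices of degree at least `d`. -/
noncomputable def cntGe (G : SimpleGraph (Fin n)) (d : ℕ) : ℕ := #{u | d ≤ G.degree u}

/-- Number of vertices of degree exactly `d`. -/
noncomputable def cntEq (G : SimpleGraph (Fin n)) (d : ℕ) : ℕ := #{u | G.degree u = d}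

/-- Number of neighbours of `v` of degree exactly `d`. -/
noncomputable def nbrEq (G : SimpleGraph (Fin n)) (v : Fin n) (d : ℕ) : ℕ :=
  #{u | G.Adj v u ∧ G.degree u = d}

/-- Number of vertices of the card `G - v` of degree at least `d`. -/
noncomputable def cardGe (G : SimpleGraph (Fin n)) (v : Fin n) (d : ℕ) : ℕ :=
  #{u | d ≤ (gcard G v).degree u}

theorem cntGe_succ (G : SimpleGraph (Fin n)) (d : ℕ) :
    cntGe G d = cntGe G (d + 1) + cntEq G d := by
  unfold cntGe cntEq
  rw [← card_union_of_disjoint]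
  · congr 1; ext u; simp; omega
  · rw [Finset.disjoint_left]; intro u; simp; omega

theorem degree_gcard (G : SimpleGraph (Fin n)) (v : Fin n) (u : {x : Fin n // x ≠ v}) :
    (gcard G v).degree u + (if G.Adj v u then 1 else 0) = G.degree u := by
  have h1 : (gcard G v).degree u = #((G.neighborFinset u).erase v) := by
    rw [← card_neighborFinset_eq_degree]
    rw [← card_map (Function.Embedding.subtype _)]
    congr 1
    ext x
    simp only [mem_map, mem_neighborFinset, Function.Embedding.coe_subtype, mem_erase]
    constructor
    · rintro ⟨y, hy, rfl⟩
      exact ⟨y.2, hy⟩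
    · rintro ⟨hx, hy⟩
      exact ⟨⟨x, hx⟩, hy, rfl⟩
  rw [h1]
  split_ifs with h
  · rw [card_erase_add_one, card_neighborFinset_eq_degree]
    simpa using h.symm
  · rw [erase_eq_of_notMem, card_neighborFinset_eq_degree, add_zero]
    simpa using fun h' => h (SimpleGraph.Adj.symm h')

theorem cardGe_eq (G : SimpleGraph (Fin n)) (v : Fin n) (d : ℕ) :
    cardGe G v d + nbrEq G v d + (if d ≤ G.degree v then 1 else 0) = cntGe G d := by
  have h1 : cardGe G v d
      = #{u : Fin n | u ≠ v ∧ d + (if G.Adj v u then 1 else 0) ≤ G.degree u} := by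
    unfold cardGe
    rw [← card_map (Function.Embedding.subtype _)]
    congr 1
    ext x
    simp only [mem_map, mem_filter, mem_univ, true_and, Function.Embedding.coe_subtype]
    constructor
    · rintro ⟨y, hy, rfl⟩
      have := degree_gcard G v y
      exact ⟨y.2, by omega⟩
    · rintro ⟨hx, hy⟩
      have := degree_gcard G v ⟨x, hx⟩
      refine ⟨⟨x, hx⟩, ?_, rfl⟩
      simp only at this
      omega
  have h2 : (if d ≤ G.degree v then 1 else 0) = #{u : Fin n | u = v ∧ d ≤ G.degree u} := by
    split_ifs with h
    · symm; rw [card_eq_one]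
      refine ⟨v, ?_⟩
      ext x; simp; rintro rfl; exact h
    · symm; rw [card_eq_zero]
      ext x; simp; rintro rfl; omega
  rw [h1, h2]
  unfold nbrEq cntGe
  rw [← card_union_of_disjoint, ← card_union_of_disjoint]
  · congr 1
    ext x
    simp only [mem_union, mem_filter, mem_univ, true_and]
    by_cases hx : x = v
    · subst hx; simp
    · by_cases ha : G.Adj v x
      · simp [hx, ha]; omega
      · simp [hx, ha]
  · rw [Finset.disjoint_left]; intro x
    simp only [mem_union, mem_filter, mem_univ, true_and]
    rintro (h | h) h'
    · exact h.1 h'.1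
    · exact G.ne_of_adj h.1 h'.1.symm
  · rw [Finset.disjoint_left]; intro x
    simp only [mem_filter, mem_univ, true_and]
    rintro h h'
    have := h.2
    rw [if_pos h'.1] at this
    omega

theorem cardGe_iso (G H : SimpleGraph (Fin n)) (v w : Fin n) (φ : gcard G v ≃g gcard H w)
    (d : ℕ) : cardGe G v d = cardGe H w d := by
  unfold cardGe
  refine card_bij (fun u _ => φ u) ?_ ?_ ?_
  · intro u hu
    simp only [mem_filter, mem_univ, true_and] at hu ⊢
    rwa [φ.degree_eq]
  · intro a _ b _ h; exact φ.injective h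
  · intro b hb
    simp only [mem_filter, mem_univ, true_and] at hb
    refine ⟨φ.symm b, ?_, by simp⟩
    simp only [mem_filter, mem_univ, true_and]
    rwa [φ.symm.degree_eq]

theorem sum_degree_gcard (G : SimpleGraph (Fin n)) (v : Fin n) :
    ∑ u, (gcard G v).degree u + 2 * G.degree v = ∑ u, G.degree u := by
  have h1 : ∑ u, G.degree u = G.degree v + ∑ u : {x : Fin n // x ≠ v}, G.degree u := by
    rw [← Finset.add_sum_erase univ _ (mem_univ v)]
    congr 1
    apply Finset.sum_subtype
    simp
  have h2 : ∑ u : {x : Fin n // x ≠ v}, (if G.Adj v u then 1 else 0) = G.degree v := by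
    have : ∑ u ∈ univ.erase v, (if G.Adj v u then 1 else 0)
        = ∑ u : {x : Fin n // x ≠ v}, (if G.Adj v u then 1 else 0) := by
      apply Finset.sum_subtype
      simp
    rw [← this, Finset.sum_erase _ (by simp), ← card_filter,
      ← card_neighborFinset_eq_degree]
    congr 1
    ext x; simp
  rw [h1, ← h2, ← Finset.sum_congr rfl (fun u _ => degree_gcard G v u), Finset.sum_add_distrib]
  omega

theorem sum_degree_iso (G H : SimpleGraph (Fin n)) (v w : Fin n) (φ : gcard G v ≃g gcard H w) :
    ∑ u, (gcard G v).degree u = ∑ u, (gcard H w).degree u := by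
  apply Fintype.sum_equiv φ.toEquiv
  intro u
  exact (φ.degree_eq u).symm

theorem sum_nbrEq (G : SimpleGraph (Fin n)) (d : ℕ) :
    ∑ v, nbrEq G v d = d * cntEq G d := by
  unfold nbrEq cntEq
  simp only [card_filter]
  rw [sum_comm, mul_sum]
  apply sum_congr rfl
  intro u _
  by_cases h : G.degree u = d
  · simp only [h, and_true, if_true, mul_one]
    rw [← h, ← card_filter, ← card_neighborFinset_eq_degree]
    congr 1
    ext x; simp [G.adj_comm]
  · simp [h]

theorem nbrEq_le (G : SimpleGraph (Fin n)) (v : Fin n) (d : ℕ) : nbrEq G v d ≤ cntEq G d := by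
  unfold nbrEq cntEq
  apply card_le_card
  intro x; simp

theorem sum_cntGe (G : SimpleGraph (Fin n)) :
    ∑ d ∈ range n, cntGe G (d + 1) = ∑ u, G.degree u := by
  unfold cntGe
  simp only [card_filter]
  rw [sum_comm]
  apply sum_congr rfl
  intro u _
  rw [← card_filter]
  have : G.degree u < n := by simpa using G.degree_lt_card_verts u
  have h : filter (fun i => i + 1 ≤ G.degree u) (range n) = range (G.degree u) := by
    ext i; simp; omega
  rw [h, card_range]

/-- Summation over the shared cards on one side. -/
theorem sum_cards (G : SimpleGraph (Fin n)) (S : Finset (Fin n)) (k : ℕ) (hS : #S + k = n)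
    (d : ℕ) : ∃ C : ℕ, C ≤ k * (1 + cntEq G d) ∧
      ∑ v ∈ S, cardGe G v d + d * cntEq G d + cntGe G d = #S * cntGe G d + C := by
  have hSc : #Sᶜ = k := by
    rw [card_compl]; simp; omega
  refine ⟨∑ v ∈ Sᶜ, (nbrEq G v d + if d ≤ G.degree v then 1 else 0), ?_, ?_⟩
  · rw [← hSc, ← smul_eq_mul]
    apply sum_le_card_nsmul
    intro v _
    have := nbrEq_le G v d
    split_ifs <;> omega
  · have h1 : ∑ v ∈ S, (cardGe G v d + (nbrEq G v d + if d ≤ G.degree v then 1 else 0))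
        = #S * cntGe G d := by
      rw [← smul_eq_mul, ← sum_const]
      apply sum_congr rfl
      intro v _
      rw [← cardGe_eq G v d]; ring
    have h2 : ∑ v, (nbrEq G v d + if d ≤ G.degree v then 1 else 0)
        = d * cntEq G d + cntGe G d := by
      rw [sum_add_distrib, sum_nbrEq, ← card_filter]; rfl
    rw [← Finset.sum_add_sum_compl S] at h2
    rw [sum_add_distrib] at h1
    omega

theorem no_larger (k : ℕ) (hn : 10000 ≤ n) (hk : 400 * k ^ 2 ≤ n) (G H : SimpleGraph (Fin n))
    (S T : Finset (Fin n)) (π : {x : Fin n // x ∈ S} ≃ {y : Fin n // y ∈ T})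
    (hS : #S + k = n) (hT : #T + k = n)
    (hπ : ∀ v : {x : Fin n // x ∈ S}, Nonempty (gcard G v.1 ≃g gcard H (π v).1)) :
    ¬ #H.edgeFinset < #G.edgeFinset := by
  intro hlt
  obtain ⟨α, hα⟩ : ∃ α, #G.edgeFinset = #H.edgeFinset + α := ⟨_, (Nat.add_sub_of_le hlt.le).symm⟩
  have hα1 : 1 ≤ α := by omega
  have hdeg : ∀ v : {x : Fin n // x ∈ S}, G.degree v.1 = H.degree (π v).1 + α := by
    intro v
    obtain ⟨φ⟩ := hπ v
    have e1 := sum_degree_gcard G v.1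
    have e2 := sum_degree_gcard H (π v).1
    have e3 := sum_degree_iso G H _ _ φ
    have e4 := sum_degrees_eq_twice_card_edges G
    have e5 := sum_degrees_eq_twice_card_edges H
    omega
  have hBA : ∀ d, cntGe H d ≤ cntGe G (d + α) + k := by
    intro d
    have hTc : #Tᶜ = k := by
      rw [card_compl]; simp; omega
    have hsub : (univ.filter fun u => d ≤ H.degree u)
        ⊆ (T.filter fun u => d ≤ H.degree u) ∪ Tᶜ := by
      intro x; simp; tauto
    have hinj : #(T.filter fun u => d ≤ H.degree u) ≤ cntGe G (d + α) := by
      unfold cntGe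
      apply card_le_card_of_injOn (fun u => if h : u ∈ T then (π.symm ⟨u, h⟩).1 else u)
      · intro u hu
        simp only [coe_filter, Set.mem_ofPred_eq, mem_univ, true_and] at hu ⊢
        rw [dif_pos hu.1, hdeg]
        have hh := congrArg (fun y : {y : Fin n // y ∈ T} => H.degree y.1)
          (π.apply_symm_apply ⟨u, hu.1⟩)
        simp only at hh
        omega
      · intro u hu u' hu' h
        simp only [coe_filter, Set.mem_ofPred_eq] at hu hu'
        simp only [dif_pos hu.1, dif_pos hu'.1] at h
        have := π.symm.injective (Subtype.ext h)
        simpa using this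
    have := (card_le_card hsub).trans (card_union_le _ _)
    unfold cntGe at *
    omega
  have hmono : ∀ d, cntGe G (d + α) ≤ cntGe G (d + 1) := by
    intro d
    unfold cntGe
    apply card_le_card
    intro x; simp; omega
  have hsumST : ∀ d, ∑ v ∈ S, cardGe G v d = ∑ w ∈ T, cardGe H w d := by
    intro d
    rw [← sum_coe_sort S, ← sum_coe_sort T]
    apply Fintype.sum_equiv π
    intro v
    obtain ⟨φ⟩ := hπ v
    exact cardGe_iso _ _ _ _ φ d
  have ha : ∀ d, (cntEq G d : ℤ) ≤ (cntGe G d : ℤ) - cntGe H d + k := by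
    intro d
    have := hBA d
    have := hmono d
    have := cntGe_succ G d
    omega
  have hb : ∀ d, (cntEq H d : ℤ) ≤ (cntGe G (d + 1) : ℤ) - cntGe H (d + 1) + k := by
    intro d
    have := ha d
    have := cntGe_succ G d
    have := cntGe_succ H d
    omega
  have hrec : ∀ d : ℕ, ∃ C D : ℕ, C ≤ k * (1 + cntEq G d) ∧ D ≤ k * (1 + cntEq H d) ∧
      ((n : ℤ) - 1 - k - d) * ((cntGe G d : ℤ) - cntGe H d)
        + d * ((cntGe G (d + 1) : ℤ) - cntGe H (d + 1)) = D - C := by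
    intro d
    obtain ⟨C, hC, e1⟩ := sum_cards G S k hS d
    obtain ⟨D, hD, e2⟩ := sum_cards H T k hT d
    refine ⟨C, D, hC, hD, ?_⟩
    rw [← hsumST] at e2
    have s1 := cntGe_succ G d
    have s2 := cntGe_succ H d
    have hS' : (#S : ℤ) = n - k := by omega
    have hT' : (#T : ℤ) = n - k := by omega
    zify at e1 e2 s1 s2
    rw [hS'] at e1
    rw [hT'] at e2
    have t1 : (cntGe G (d + 1) : ℤ) = cntGe G d - cntEq G d := by linarith
    have t2 : (cntGe H (d + 1) : ℤ) = cntGe H d - cntEq H d := by linarith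
    rw [t1, t2]
    linarith
  have hz := delta_zero n k (fun d => (cntGe G d : ℤ) - cntGe H d) hn hk
    (by intro d; have := ha d; omega)
    (by
      intro d
      obtain ⟨C, D, hC, hD, e⟩ := hrec d
      rw [e]
      have : (k : ℤ) * (1 + cntEq G d) ≤ k * (1 + k + ((cntGe G d : ℤ) - cntGe H d)) :=
        mul_le_mul_of_nonneg_left (by linarith [ha d]) (by positivity)
      zify at hC
      linarith [Int.natCast_nonneg D])
    (by
      intro d
      obtain ⟨C, D, hC, hD, e⟩ := hrec d
      rw [e]
      have : (k : ℤ) * (1 + cntEq H d) ≤ k * (1 + k + ((cntGe G (d + 1) : ℤ) - cntGe H (d + 1))) :=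
        mul_le_mul_of_nonneg_left (by linarith [hb d]) (by positivity)
      zify at hD
      linarith [Int.natCast_nonneg C])
  have hsum : ∑ u, G.degree u = ∑ u, H.degree u := by
    rw [← sum_cntGe, ← sum_cntGe]
    apply sum_congr rfl
    intro d hd
    have := hz (d + 1) (by simpa using hd)
    omega
  rw [sum_degrees_eq_twice_card_edges, sum_degrees_eq_twice_card_edges] at hsum
  omega

end GraphPart

theorem size_reconstruction :
    ∃ n₀ : ℕ, ∀ n : ℕ, n₀ ≤ n → ∀ k : ℕ, (k : ℝ) ≤ 0.05 * Real.sqrt n →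
      ∀ G H : SimpleGraph (Fin n), ShareManyCards G H (n - k) →
        G.edgeSet.ncard = H.edgeSet.ncard := by
  classical
  refine ⟨10000, ?_⟩
  rintro n hn k hk G H ⟨S, T, π, hS, hT, hπ⟩
  have hk2 : 400 * k ^ 2 ≤ n := by
    have h0 : (0 : ℝ) ≤ k := by positivity
    have hs := Real.sq_sqrt (show (0 : ℝ) ≤ n by positivity)
    have : 400 * (k : ℝ) ^ 2 ≤ n := by
      have h1 : (k : ℝ) ^ 2 ≤ (0.05 * Real.sqrt n) ^ 2 := by gcongr
      rw [mul_pow, hs] at h1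
      norm_num at h1
      linarith
    exact_mod_cast this
  have hkn : k ≤ n := by nlinarith
  have h1 := no_larger k hn hk2 G H S T π (by omega) (by omega) hπ
  have h2 := no_larger k hn hk2 H G T S π.symm (by omega) (by omega) (by
    intro w
    obtain ⟨φ⟩ := hπ (π.symm w)
    rw [Equiv.apply_symm_apply] at φ
    exact ⟨φ.symm⟩)
  have hG : G.edgeSet.ncard = G.edgeFinset.card := by
    rw [← coe_edgeFinset, Set.ncard_coe_finset]
  have hH : H.edgeSet.ncard = H.edgeFinset.card := by
    rw [← coe_edgeFinset, Set.ncard_coe_finset]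
  rw [hG, hH]
  exact le_antisymm (by convert not_lt.1 h1) (by convert not_lt.1 h2)
end
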